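/- arXiv:2507.04254 — 2 statements merged into one kernel-verified Lean document; each statement's English description precedes it below -/
import Mathlib

section
/- There exists a function f : ℕ → ℝ with f(k)/k → 0 as k → ∞ such that for every odd integer k ≥ 3 and every finite simple graph G, the mod k chromatic index satisfies χ'_k(G) ≤ 7k + f(k). -/
/-- The degree of vertex `v` in the colour class `i` of the edge-colouring `c` of `G`. -/
noncomputable def colorClassDegree {V : Type*} (G : SimpleGraph V) {n : ℕ}
    (c : G.edgeSet → Fin n) (i : Fin n) (v : V) : ℕ :=
  {u : V | ∃ h : G.Adj v u, c ⟨s(v, u), h⟩ = i}.ncard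

/-- `c` is a `χ'_k`-colouring of `G`: in every colour class, every vertex of non-zero degree
has degree congruent to `1` modulo `k`. -/
def IsModKColoring {V : Type*} (k : ℕ) (G : SimpleGraph V) {n : ℕ}
    (c : G.edgeSet → Fin n) : Prop :=
  ∀ (i : Fin n) (v : V),
    colorClassDegree G c i v ≠ 0 → colorClassDegree G c i v % k = 1

/-- The mod `k` chromatic index of `G`: the least number of colours in a `χ'_k`-colouring. -/
noncomputable def modChromaticIndex {V : Type*} (k : ℕ) (G : SimpleGraph V) : ℕ :=
  sInf {n : ℕ | ∃ c : G.edgeSet → Fin n, IsModKColoring k G c}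

/-- The edges `e ∈ E` can be coloured from their lists `A e` so that every colour is used
`0` times or a number of times congruent to `1` modulo `k`. -/
def StarColorable {ι K : Type*} [DecidableEq K] (k : ℕ) (E : Finset ι) (A : ι → Finset K) :
    Prop :=
  ∃ φ : ι → K, (∀ e ∈ E, φ e ∈ A e) ∧
    ∀ c, (E.filter (φ · = c)).card = 0 ∨ (E.filter (φ · = c)).card % k = 1

theorem sum_card_eq_sum_popularity {ι K : Type*} [DecidableEq K] (E : Finset ι)
    (A : ι → Finset K) (P : Finset K) (h : ∀ e ∈ E, A e ⊆ P) :
    ∑ e ∈ E, (A e).card = ∑ c ∈ P, (E.filter (c ∈ A ·)).card := by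
  have := Finset.sum_card_bipartiteAbove_eq_sum_card_bipartiteBelow (s := E) (t := P)
    (fun e c => c ∈ A e)
  rw [← show ∑ c ∈ P, (Finset.bipartiteBelow (fun e c => c ∈ A e) E c).card =
    ∑ c ∈ P, (E.filter (c ∈ A ·)).card from rfl, ← this]
  refine Finset.sum_congr rfl fun e he => ?_
  congr 1
  ext c
  simp only [Finset.bipartiteAbove, Finset.mem_filter]
  exact ⟨fun hc => ⟨h e he hc, hc⟩, fun hc => hc.2⟩

/-- The slack `u` is large enough compared with `k` for palettes of up to `27 (k + u)` colours. -/
def SufficientSlack (k u : ℕ) : Prop :=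
  27 * (k + u) * (27 * (k + u) + 1) * 53 ^ u ≤ 54 ^ u

section StarColorable

variable {ι K : Type*} [DecidableEq ι] [DecidableEq K]

theorem StarColorable.of_erase {k : ℕ} {E F : Finset ι} {A : ι → Finset K} {c : K}
    (hF : F ⊆ E) (hFk : F.card % k = 1) (hc : ∀ e ∈ F, c ∈ A e)
    (h : StarColorable k (E \ F) fun e => (A e).erase c) : StarColorable k E A := by
  obtain ⟨φ, hφ, hcount⟩ := h
  refine ⟨fun e => if e ∈ F then c else φ e, fun e he => ?_, fun d => ?_⟩
  · by_cases heF : e ∈ F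
    · simpa [heF] using hc e heF
    · simpa [heF] using Finset.mem_of_mem_erase (hφ e (Finset.mem_sdiff.2 ⟨he, heF⟩))
  · by_cases hd : d = c
    · right
      convert hFk using 3
      ext e
      simp only [Finset.mem_filter]
      constructor
      · rintro ⟨he, h2⟩
        by_contra heF
        rw [if_neg heF] at h2
        have := hφ e (Finset.mem_sdiff.2 ⟨he, heF⟩)
        simp [h2, hd] at this
      · intro heF
        exact ⟨hF heF, by simp [heF, hd]⟩
    · have : E.filter (fun e => (if e ∈ F then c else φ e) = d) = (E \ F).filter (φ · = d) := by
        ext e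
        simp only [Finset.mem_filter, Finset.mem_sdiff]
        by_cases heF : e ∈ F <;> simp [heF, Ne.symm hd]
      rw [this]
      exact hcount d

theorem StarColorable.of_hall {k : ℕ} (hk : 2 ≤ k) {E : Finset ι} [Nonempty K]
    {A : ι → Finset K} (h : ∀ S ⊆ E, S.card ≤ (S.biUnion A).card) : StarColorable k E A := by
  have hall := (Finset.all_card_le_biUnion_card_iff_exists_injective
    (fun e : {e // e ∈ E} => A e)).1 (by
      intro S
      have := h (S.map (Function.Embedding.subtype _)) (by
        intro e he
        simp only [Finset.mem_map, Function.Embedding.subtype_apply] at he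
        obtain ⟨a, _, rfl⟩ := he
        exact a.2)
      rw [Finset.card_map] at this
      refine this.trans (Finset.card_le_card ?_)
      intro c
      simp)
  obtain ⟨f, hf, hfA⟩ := hall
  refine ⟨fun e => if he : e ∈ E then f ⟨e, he⟩ else Classical.arbitrary K, fun e he => ?_,
    fun c => ?_⟩
  · simpa [he] using hfA ⟨e, he⟩
  · have : (E.filter (fun e => (if he : e ∈ E then f ⟨e, he⟩ else Classical.arbitrary K) = c)).card
        ≤ 1 := by
      rw [Finset.card_le_one]
      intro a ha b hb
      rw [Finset.mem_filter] at ha hb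
      obtain ⟨ha, ha'⟩ := ha
      obtain ⟨hb, hb'⟩ := hb
      rw [dif_pos ha] at ha'
      rw [dif_pos hb] at hb'
      simpa using hf (ha'.trans hb'.symm)
    rcases Nat.le_one_iff_eq_zero_or_eq_one.1 this with h0 | h1
    · exact Or.inl h0
    · right
      rw [h1, Nat.mod_eq_of_lt hk]

theorem starColorable_of_card_mul_pow_le [Fintype K] [Nonempty K] {k q u : ℕ} (hk : 2 ≤ k)
    (hq0 : 0 < q) (hq : 2 * Fintype.card K ≤ q * (k + u)) (j : ℕ) :
    ∀ (E : Finset ι) (A : ι → Finset K), (∀ e ∈ E, k + u + j ≤ (A e).card) →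
      E.card * (q - 1) ^ j ≤ k * q ^ j → StarColorable k E A := by
  induction j with
  | zero =>
    intro E A hA hE
    refine .of_hall hk fun S hS => ?_
    obtain rfl | ⟨e, he⟩ := S.eq_empty_or_nonempty
    · simp
    · have h1 := Finset.card_le_card hS
      have h2 := hA e (hS he)
      have h3 := Finset.card_le_card (Finset.subset_biUnion_of_mem A he)
      simp only [pow_zero, mul_one] at hE
      omega
  | succ j ih =>
    intro E A hA hE
    by_cases hall : ∀ S ⊆ E, S.card ≤ (S.biUnion A).card
    · exact .of_hall hk hall
    push Not at hall
    obtain ⟨S, hSE, hS⟩ := hall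
    obtain ⟨c0, hc0⟩ : ∃ c, k + 1 ≤ (E.filter (c ∈ A ·)).card := by
      by_contra! hlt
      have h1 : S.card * (k + 1) ≤ ∑ e ∈ S, (A e).card := by
        rw [← smul_eq_mul]
        refine Finset.card_nsmul_le_sum _ _ _ fun e he => ?_
        have := hA e (hSE he)
        omega
      rw [sum_card_eq_sum_popularity S A (S.biUnion A)
        fun e he => Finset.subset_biUnion_of_mem A he] at h1
      have h2 : ∑ c ∈ S.biUnion A, (S.filter (c ∈ A ·)).card ≤ (S.biUnion A).card * k := by
        rw [← smul_eq_mul]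
        refine Finset.sum_le_card_nsmul _ _ _ fun c _ => ?_
        have := hlt c
        have := Finset.card_le_card (Finset.filter_subset_filter (c ∈ A ·) hSE)
        omega
      have := Nat.mul_le_mul_right k hS.le
      have : S.card * (k + 1) = S.card * k + S.card := by ring
      omega
    obtain ⟨c, hc⟩ := Finite.exists_max fun c => (E.filter (c ∈ A ·)).card
    set Δ := (E.filter (c ∈ A ·)).card with hΔ
    have hΔk : k + 1 ≤ Δ := hc0.trans (hc c0)
    have havg : E.card * (k + u) ≤ Fintype.card K * Δ := by
      have h1 : E.card * (k + u) ≤ ∑ e ∈ E, (A e).card := by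
        rw [← smul_eq_mul]
        refine Finset.card_nsmul_le_sum _ _ _ fun e he => ?_
        have := hA e he
        omega
      rw [sum_card_eq_sum_popularity E A Finset.univ fun e he => Finset.subset_univ _] at h1
      refine h1.trans ?_
      rw [← smul_eq_mul, ← Finset.card_univ]
      exact Finset.sum_le_card_nsmul _ _ _ fun c _ => hc c
    have hr : (Δ - 1) % k < k := Nat.mod_lt _ (by omega)
    have hdm := Nat.div_add_mod (Δ - 1) k
    obtain ⟨F, hF, hFc⟩ := Finset.exists_subset_card_eq (s := E.filter (c ∈ A ·))
      (n := Δ - (Δ - 1) % k) (by omega)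
    have hFE : F ⊆ E := hF.trans (Finset.filter_subset _ _)
    have hdiv : 1 ≤ (Δ - 1) / k := (Nat.one_le_div_iff (by omega)).2 (by omega)
    have hkd : k ≤ k * ((Δ - 1) / k) := Nat.le_mul_of_pos_right _ hdiv
    refine .of_erase (F := F) (c := c) hFE ?_ (fun e he => (Finset.mem_filter.1 (hF he)).2)
      (ih _ _ (fun e he => ?_) ?_)
    · have : F.card = 1 + k * ((Δ - 1) / k) := by omega
      rw [this, Nat.add_mul_mod_self_left, Nat.mod_eq_of_lt hk]
    · have h1 := hA e (Finset.mem_sdiff.1 he).1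
      have h2 := Finset.pred_card_le_card_erase (s := A e) (a := c)
      omega
    · have hcard : (E \ F).card + F.card = E.card := Finset.card_sdiff_add_card_eq_card hFE
      have h2F : Δ ≤ 2 * F.card := by omega
      have hn : 0 < Fintype.card K := Fintype.card_pos
      have hqF : E.card ≤ q * F.card := by
        have : 2 * Fintype.card K * E.card ≤ 2 * Fintype.card K * (q * F.card) := by
          calc 2 * Fintype.card K * E.card ≤ q * (k + u) * E.card := Nat.mul_le_mul_right _ hq
            _ = q * (E.card * (k + u)) := by ring
            _ ≤ q * (Fintype.card K * Δ) := Nat.mul_le_mul_left _ havg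
            _ ≤ q * (Fintype.card K * (2 * F.card)) := by gcongr
            _ = _ := by ring
        exact Nat.le_of_mul_le_mul_left this (by omega)
      have hm : q * (E \ F).card ≤ E.card * (q - 1) := by
        obtain ⟨q, rfl⟩ : ∃ q', q = q' + 1 := ⟨q - 1, by omega⟩
        simp only [Nat.add_sub_cancel]
        nlinarith
      have : q * ((E \ F).card * (q - 1) ^ j) ≤ q * (k * q ^ j) := by
        calc q * ((E \ F).card * (q - 1) ^ j) = q * (E \ F).card * (q - 1) ^ j := by ring
          _ ≤ E.card * (q - 1) * (q - 1) ^ j := Nat.mul_le_mul_right _ hm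
          _ = E.card * (q - 1) ^ (j + 1) := by ring
          _ ≤ k * q ^ (j + 1) := hE
          _ = _ := by ring
      exact Nat.le_of_mul_le_mul_left this hq0

theorem starColorable_of_le_card_aux [Fintype K] [Nonempty K] {k q u : ℕ} (hk : 2 ≤ k)
    (hq0 : 0 < q) (hq : 2 * Fintype.card K ≤ q * (k + u))
    (hu : Fintype.card K * (Fintype.card K + 1) * (q - 1) ^ u ≤ q ^ u) (P : Finset K) :
    ∀ (E Z : Finset ι) (A : ι → Finset K), (∀ e ∈ E, A e ⊆ P) →
      (∀ e ∈ E, k + 2 * u ≤ (A e).card) → (∀ e ∈ E, e ∉ Z → k + 2 * u + 1 ≤ (A e).card) →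
      Z.card + k * P.card ≤ k * Fintype.card K → StarColorable k E A := by
  induction P using Finset.strongInduction with
  | H P ih =>
    intro E Z A hP hA hA' hZ
    by_cases hex : ∃ c ∈ P, k * Fintype.card K + k ≤ (E.filter (c ∈ A ·)).card
    · obtain ⟨c, hcP, hc⟩ := hex
      set Δ := (E.filter (c ∈ A ·)).card with hΔ
      have hr : (Δ - 1) % k < k := Nat.mod_lt _ (by omega)
      have hdm := Nat.div_add_mod (Δ - 1) k
      have hS : (Δ - 1) % k ≤ (E.filter (c ∈ A ·) \ Z).card := by
        have := Finset.le_card_sdiff Z (E.filter (c ∈ A ·))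
        have : Z.card ≤ k * Fintype.card K := by omega
        omega
      obtain ⟨S, hS, hSc⟩ := Finset.exists_subset_card_eq hS
      have hSP : S ⊆ E.filter (c ∈ A ·) := hS.trans Finset.sdiff_subset
      have hFS := Finset.card_sdiff_add_card_eq_card hSP
      refine .of_erase (F := E.filter (c ∈ A ·) \ S) (c := c)
        (Finset.sdiff_subset.trans (Finset.filter_subset _ _)) ?_
        (fun e he => (Finset.mem_filter.1 (Finset.mem_sdiff.1 he).1).2)
        (ih (P.erase c) (Finset.erase_ssubset hcP) _ (Z ∪ S) _ ?_ ?_ ?_ ?_)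
      · have : (E.filter (c ∈ A ·) \ S).card = 1 + k * ((Δ - 1) / k) := by
          have : 1 ≤ Δ := by omega
          omega
        rw [this, Nat.add_mul_mod_self_left, Nat.mod_eq_of_lt hk]
      · intro e he
        exact Finset.erase_subset_erase _ (hP e (Finset.mem_sdiff.1 he).1)
      · intro e he
        simp only [Finset.mem_sdiff, Finset.mem_filter, not_and, not_not] at he
        obtain ⟨he, heS⟩ := he
        by_cases hce : c ∈ A e
        · have heZ := (Finset.mem_sdiff.1 (hS (heS ⟨he, hce⟩))).2
          rw [Finset.card_erase_of_mem hce]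
          have := hA' e he heZ
          omega
        · rw [Finset.erase_eq_of_notMem hce]
          exact hA e he
      · intro e he heZ
        simp only [Finset.mem_sdiff, Finset.mem_filter, not_and, not_not] at he
        obtain ⟨he, heS⟩ := he
        simp only [Finset.mem_union, not_or] at heZ
        rw [Finset.erase_eq_of_notMem fun hce => heZ.2 (heS ⟨he, hce⟩)]
        exact hA' e he heZ.1
      · have h1 := Finset.card_union_le Z S
        have h2 := Finset.card_erase_add_one hcP
        have : k * P.card = k * (P.erase c).card + k := by rw [← h2]; ring
        omega
    · push Not at hex
      refine starColorable_of_card_mul_pow_le hk hq0 hq u E A (fun e he => ?_) ?_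
      · have := hA e he
        omega
      · set n := Fintype.card K
        have h1 : E.card * 1 ≤ ∑ e ∈ E, (A e).card := by
          rw [← smul_eq_mul]
          refine Finset.card_nsmul_le_sum _ _ _ fun e he => ?_
          have := hA e he
          omega
        rw [sum_card_eq_sum_popularity E A P hP] at h1
        have h2 : ∑ c ∈ P, (E.filter (c ∈ A ·)).card ≤ P.card * (k * n + k) := by
          rw [← smul_eq_mul]
          exact Finset.sum_le_card_nsmul _ _ _ fun c hc => (hex c hc).le
        have h3 : P.card ≤ n := Finset.card_le_univ P
        calc E.card * (q - 1) ^ u ≤ n * (k * n + k) * (q - 1) ^ u := by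
              refine Nat.mul_le_mul_right _ ?_
              rw [mul_one] at h1
              exact h1.trans (h2.trans (Nat.mul_le_mul_right _ h3))
          _ = k * (n * (n + 1) * (q - 1) ^ u) := by ring
          _ ≤ k * q ^ u := Nat.mul_le_mul_left _ hu

/-- Edges with lists of size at least `k + 2 * u + 1` can be coloured so that every colour class
is empty or has size `1` modulo `k`, provided `u` is not too small. -/
theorem starColorable_of_le_card [Fintype K] [Nonempty K] {k u : ℕ} (hk : 2 ≤ k)
    (hu : SufficientSlack k u) (hK : Fintype.card K ≤ 27 * (k + u)) (E : Finset ι)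
    (A : ι → Finset K) (hA : ∀ e ∈ E, k + 2 * u + 1 ≤ (A e).card) : StarColorable k E A := by
  refine starColorable_of_le_card_aux (q := 54) hk (by norm_num) (by omega) ?_ Finset.univ E ∅ A
    (fun _ _ => Finset.subset_univ _) (fun e he => (Nat.le_succ _).trans (hA e he))
    (fun e he _ => hA e he) (by simp)
  refine le_trans ?_ hu
  gcongr

end StarColorable

/-- Colour the edges vertex by vertex in increasing order, all edges to later vertices at once. -/
theorem exists_sequential_coloring {V K : Type*} [Fintype V] [DecidableEq V] [Fintype K]
    [DecidableEq K] [Nonempty K] {k u : ℕ} (hk : 2 ≤ k) (hu : SufficientSlack k u)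
    (hK : Fintype.card K ≤ 27 * (k + u)) (M : SimpleGraph V) [DecidableRel M.Adj] (ord : V → ℕ)
    (hord : Function.Injective ord) (B : V → Finset K)
    (hB : ∀ v w, M.Adj v w → ord v < ord w → (B v).card + (B w).card +
      (Finset.univ.filter fun x => M.Adj v x ∧ ord x < ord v).card +
      (Finset.univ.filter fun x => M.Adj w x ∧ ord x < ord w).card + k + 2 * u
        ≤ Fintype.card K) :
    ∃ col : V → V → K, (∀ v w, M.Adj v w → col v w = col w v) ∧
      (∀ v w, M.Adj v w → col v w ∉ B v) ∧
      ∀ v c, (Finset.univ.filter fun w => M.Adj v w ∧ col v w = c).card = 0 ∨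
        (Finset.univ.filter fun w => M.Adj v w ∧ col v w = c).card % k = 1 := by
  have key : ∀ n : ℕ, ∃ col : V → V → K, (∀ v w, M.Adj v w → col v w = col w v) ∧
      (∀ v w, M.Adj v w → ord v < n ∨ ord w < n → col v w ∉ B v) ∧
      (∀ v c, ord v < n → (Finset.univ.filter fun w => M.Adj v w ∧ col v w = c).card = 0 ∨
        (Finset.univ.filter fun w => M.Adj v w ∧ col v w = c).card % k = 1) ∧
      (∀ v w w', n ≤ ord v → M.Adj v w → M.Adj v w' → ord w < n → ord w' < n →
        col v w = col v w' → w = w') := by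
    intro n
    induction n with
    | zero => exact ⟨fun _ _ => Classical.arbitrary K, by simp⟩
    | succ n ih =>
      obtain ⟨col, hsymm, havoid, hcount, hinj⟩ := ih
      by_cases hv : ∃ v, ord v = n
      · obtain ⟨v, hv⟩ := hv
        have hne : ∀ x, ord x < n + 1 → x ≠ v → ord x < n := fun x hx hxv => by
          have : ord x ≠ ord v := fun h => hxv (hord h)
          omega
        set E := Finset.univ.filter fun w => M.Adj v w ∧ n < ord w with hE
        have hmemE : ∀ w, w ∈ E ↔ M.Adj v w ∧ n < ord w := fun w => by simp [hE]
        let used : V → Finset K := fun w =>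
          (Finset.univ.filter fun x => M.Adj w x ∧ ord x < n).image (col w)
        have hused : ∀ w x, M.Adj w x → ord x < n → col w x ∈ used w := fun w x h1 h2 =>
          Finset.mem_image_of_mem _ (by simp [h1, h2])
        obtain ⟨φ, hφ, hφc⟩ := starColorable_of_le_card hk hu hK E
          (fun w => Finset.univ \ (B v ∪ B w ∪ used v ∪ used w)) (by
            intro w hw
            rw [hmemE] at hw
            have h0 := hB v w hw.1 (by omega)
            have h1 := Finset.le_card_sdiff (B v ∪ B w ∪ used v ∪ used w) Finset.univ
            have h2 := Finset.card_union_le (B v ∪ B w ∪ used v) (used w)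
            have h3 := Finset.card_union_le (B v ∪ B w) (used v)
            have h4 := Finset.card_union_le (B v) (B w)
            have h5 : (used v).card ≤
                (Finset.univ.filter fun x => M.Adj v x ∧ ord x < ord v).card := by
              rw [hv]
              exact Finset.card_image_le
            have h6 : (used w).card <
                (Finset.univ.filter fun x => M.Adj w x ∧ ord x < ord w).card := by
              refine Finset.card_image_le.trans_lt (Finset.card_lt_card ?_)
              rw [Finset.ssubset_iff_of_subset]
              · exact ⟨v, by simpa using ⟨hw.1.symm, by omega⟩, by simp [hv]⟩
              · intro x
                simp only [Finset.mem_filter, Finset.mem_univ, true_and]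
                exact fun h => ⟨h.1, by omega⟩
            rw [Finset.card_univ] at h1
            omega)
        have hφ' : ∀ w ∈ E, φ w ∉ B v ∧ φ w ∉ B w ∧ φ w ∉ used v ∧ φ w ∉ used w := by
          intro w hw
          have := hφ w hw
          simp only [Finset.mem_sdiff, Finset.mem_univ, true_and, Finset.mem_union, not_or] at this
          tauto
        have hvE : v ∉ E := by simp [hmemE]
        refine ⟨fun a b => if a = v ∧ b ∈ E then φ b else if b = v ∧ a ∈ E then φ a else col a b,
          ?_, ?_, ?_, ?_⟩
        · intro a b hab
          have := hsymm a b hab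
          grind
        · intro a b hab hlt
          have h1 := havoid a b hab
          have h2 := hab.symm
          have h3 : a ≠ b := hab.ne
          have h4 := hne a
          have h5 := hne b
          have h6 := hφ' a
          have h7 := hφ' b
          have h8 := hmemE a
          have h9 := hmemE b
          clear hφ' hφ hφc hE hB hinj hcount havoid hused hsymm hmemE hne
          clear_value E used
          grind
        · intro a c ha
          by_cases hav : a = v
          · subst hav
            have hfil : (Finset.univ.filter fun w => M.Adj a w ∧ (if a = a ∧ w ∈ E then φ w else
                if w = a ∧ a ∈ E then φ a else col a w) = c) =
                (Finset.univ.filter fun w => M.Adj a w ∧ ord w < n ∧ col a w = c) ∪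
                  E.filter (φ · = c) := by
              ext w
              have h1 := hmemE w
              have h2 := hne w
              have h3 : M.Adj a w → w ≠ a := fun h => h.ne'
              simp only [Finset.mem_filter, Finset.mem_univ, true_and, Finset.mem_union]
              grind
            rw [hfil]
            by_cases hc : ∃ x, M.Adj a x ∧ ord x < n ∧ col a x = c
            · obtain ⟨x, hx, hxn, hxc⟩ := hc
              right
              have h1 :
                  (Finset.univ.filter fun w => M.Adj a w ∧ ord w < n ∧ col a w = c) = {x} := by
                ext y
                simp only [Finset.mem_filter, Finset.mem_univ, true_and, Finset.mem_singleton]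
                constructor
                · rintro ⟨h1, h2, h3⟩
                  exact hinj a y x hv.ge h1 hx h2 hxn (h3.trans hxc.symm)
                · rintro rfl
                  exact ⟨hx, hxn, hxc⟩
              have h2 : E.filter (φ · = c) = ∅ := by
                refine Finset.filter_eq_empty_iff.2 fun w hw hwc => ?_
                have := (hφ' w hw).2.2.1
                rw [hwc, ← hxc] at this
                exact this (hused a x hx hxn)
              rw [h1, h2, Finset.union_empty, Finset.card_singleton, Nat.mod_eq_of_lt hk]
            · push Not at hc
              have h1 : (Finset.univ.filter fun w => M.Adj a w ∧ ord w < n ∧ col a w = c) = ∅ :=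
                Finset.filter_eq_empty_iff.2 fun w _ h => hc w h.1 h.2.1 h.2.2
              rw [h1, Finset.empty_union]
              exact hφc c
          · have h1 := hne a ha hav
            have h2 : a ∉ E := by
              rw [hmemE]
              omega
            simpa [hav, h2] using hcount a c h1
        · intro a w w' ha hw hw' hwn hwn' heq
          have hav : a ≠ v := by
            rintro rfl
            omega
          have h1 : M.Adj a v → a ∈ E := fun h => (hmemE a).2 ⟨h.symm, by omega⟩
          by_cases hwv : w = v <;> by_cases hwv' : w' = v
          · rw [hwv, hwv']
          · subst hwv
            have h2 := (hφ' a (h1 hw)).2.2.2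
            simp only [hav, false_and, if_false, true_and, h1 hw, if_true, hwv'] at heq
            rw [heq] at h2
            exact (h2 (hused a w' hw' (hne w' hwn' hwv'))).elim
          · subst hwv'
            have h2 := (hφ' a (h1 hw')).2.2.2
            simp only [hav, false_and, if_false, true_and, h1 hw', if_true, hwv] at heq
            rw [← heq] at h2
            exact (h2 (hused a w hw (hne w hwn hwv))).elim
          · simp only [hav, false_and, if_false, hwv, hwv'] at heq
            exact hinj a w w' (by omega) hw hw' (hne w hwn hwv) (hne w' hwn' hwv') heq
      · push Not at hv
        have hlt : ∀ x, ord x < n + 1 ↔ ord x < n := fun x => by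
          have := hv x
          omega
        refine ⟨col, hsymm, ?_, ?_, ?_⟩
        · simpa only [hlt] using havoid
        · simpa only [hlt] using hcount
        · simp only [hlt]
          exact fun v w w' h => hinj v w w' (by omega)
  obtain ⟨col, hsymm, havoid, hcount, -⟩ := key (Finset.univ.sup ord + 1)
  have hlt : ∀ v, ord v < Finset.univ.sup ord + 1 := fun v =>
    Nat.lt_succ_of_le (Finset.le_sup (Finset.mem_univ v))
  exact ⟨col, hsymm, fun v w h => havoid v w h (Or.inl (hlt v)), fun v c => hcount v c (hlt v)⟩

/-- Labelling the arcs `w → v`, `w ∈ In v`, with bipartite classes, processing the heads one by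
one. The map `ρ j` keeps track of the components of the class `j`: each vertex without an
outgoing arc in the class is a root. -/
theorem exists_class_labelling {V K : Type*} [Fintype V] [DecidableEq V] [Fintype K]
    [DecidableEq K] [Nonempty K] {k u D : ℕ} (hk : 2 ≤ k) (hu : SufficientSlack k u)
    (hK : Fintype.card K ≤ 27 * (k + u)) (hDK : D + k + 3 * u + 1 ≤ Fintype.card K)
    (In : V → Finset V) (hD : ∀ w, (Finset.univ.filter fun v => w ∈ In v).card ≤ D) :
    ∃ (lab : V → V → Option K) (π : K → V → Bool),
      (∀ w v v' j, w ∈ In v → w ∈ In v' → lab w v = some j → lab w v' = some j → v = v') ∧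
      (∀ v j, ((In v).filter (lab · v = some j)).card = 0 ∨
        ((In v).filter (lab · v = some j)).card % k = 1) ∧
      (∀ w v j, w ∈ In v → lab w v = some j → π j w ≠ π j v) ∧
      ∀ v, ((In v).filter (lab · v = none)).card * u ≤ Fintype.card K := by
  have key : ∀ P : Finset V, ∃ (lab : V → V → Option K) (ρ : K → V → V) (π : K → V → Bool),
      (∀ w v v' j, v ∈ P → v' ∈ P → w ∈ In v → w ∈ In v' → lab w v = some j →
        lab w v' = some j → v = v') ∧
      (∀ v j, v ∈ P → ((In v).filter (lab · v = some j)).card = 0 ∨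
        ((In v).filter (lab · v = some j)).card % k = 1) ∧
      (∀ w v j, v ∈ P → w ∈ In v → lab w v = some j → π j w ≠ π j v) ∧
      (∀ v ∈ P, ((In v).filter (lab · v = none)).card * u ≤ Fintype.card K) ∧
      (∀ w v j, v ∈ P → w ∈ In v → lab w v = some j → ρ j w = ρ j v) ∧
      ∀ w j, (∀ v ∈ P, w ∈ In v → lab w v ≠ some j) → ρ j w = w := by
    intro P
    induction P using Finset.induction_on with
    | empty => exact ⟨fun _ _ => none, fun _ v => v, fun _ _ => true, by simp⟩
    | insert v P hv ih =>
      obtain ⟨lab, ρ, π, hinj, hcount, hπ, hspec, hρ, hroot⟩ := ih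
      let J : V → Finset K := fun w => Finset.univ.filter fun j => ρ j v = w
      let U : V → Finset K := fun w =>
        Finset.univ.filter fun j => ∃ x ∈ P, w ∈ In x ∧ lab w x = some j
      have hJ : ∀ w j, j ∈ J w ↔ ρ j v = w := fun w j => by simp [J]
      have hU : ∀ w j, j ∈ U w ↔ ∃ x ∈ P, w ∈ In x ∧ lab w x = some j := fun w j => by simp [U]
      have hUD : ∀ w, (U w).card ≤ D := by
        intro w
        have : U w ⊆ (Finset.univ.filter fun v => w ∈ In v).image
            fun x => (lab w x).getD (Classical.arbitrary K) := by
          intro j hj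
          obtain ⟨x, -, hx, hxj⟩ := (hU w j).1 hj
          exact Finset.mem_image.2 ⟨x, by simp [hx], by simp [hxj]⟩
        exact (Finset.card_le_card this).trans (Finset.card_image_le.trans (hD w))
      set E := (In v).filter fun w => (J w).card < u with hE
      have hmemE : ∀ w, w ∈ E ↔ w ∈ In v ∧ (J w).card < u := fun w => by simp [hE]
      obtain ⟨φ, hφ, hφc⟩ := starColorable_of_le_card hk hu hK E
        (fun w => Finset.univ \ (U w ∪ J w)) (by
          intro w hw
          have h1 := Finset.le_card_sdiff (U w ∪ J w) Finset.univ
          have h2 := Finset.card_union_le (U w) (J w)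
          have h3 := hUD w
          have h4 := ((hmemE w).1 hw).2
          rw [Finset.card_univ] at h1
          omega)
      have hφU : ∀ w ∈ E, ∀ x ∈ P, w ∈ In x → lab w x ≠ some (φ w) := by
        intro w hw x hx hwx h
        have := hφ w hw
        simp only [Finset.mem_sdiff, Finset.mem_univ, true_and, Finset.mem_union, not_or] at this
        exact this.1 ((hU w _).2 ⟨x, hx, hwx, h⟩)
      have hφJ : ∀ w ∈ E, ρ (φ w) v ≠ w := by
        intro w hw h
        have := hφ w hw
        simp only [Finset.mem_sdiff, Finset.mem_univ, true_and, Finset.mem_union, not_or] at this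
        exact this.2 ((hJ w _).2 h)
      have hφρ : ∀ w ∈ E, ρ (φ w) w = w := fun w hw => hroot w _ (hφU w hw)
      have hPv : ∀ x ∈ P, x ≠ v := fun x hx h => hv (h ▸ hx)
      refine ⟨fun w x => if x = v then if w ∈ E then some (φ w) else none else lab w x,
        fun j x => if ρ j x ∈ E ∧ φ (ρ j x) = j then ρ j v else ρ j x,
        fun j x => if ρ j x ∈ E ∧ φ (ρ j x) = j then
          xor (xor (π j x) (π j (ρ j x))) (!π j v) else π j x, ?_, ?_, ?_, ?_, ?_, ?_⟩
      · intro w x x' j hx hx' hwx hwx' h h'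
        have h1 := hinj w x x' j
        have h2 := hφU w
        simp only [Finset.mem_insert] at hx hx'
        clear hE hφ hφc hcount hspec
        clear_value E
        grind
      · intro x j hx
        by_cases hxv : x = v
        · subst hxv
          have : ((In x).filter fun w =>
              (if x = x then if w ∈ E then some (φ w) else none else lab w x) = some j) =
              E.filter (φ · = j) := by
            ext w
            have := hmemE w
            simp only [if_true, Finset.mem_filter]
            by_cases hw : w ∈ E
            · simp [hw, (this.1 hw).1]
            · simp [hw]
          rw [this]
          exact hφc j
        · simpa [hxv] using hcount x j (Finset.mem_of_mem_insert_of_ne hx hxv)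
      · intro w x j hx hwx h
        by_cases hxv : x = v
        · subst hxv
          have hwE : w ∈ E := by
            by_contra hw
            simp [hw] at h
          simp only [if_true, hwE, Option.some.injEq] at h
          subst h
          have h1 := hφρ w hwE
          have h2 : ¬ (ρ (φ w) x ∈ E ∧ φ (ρ (φ w) x) = φ w) := fun h3 => by
            have := hφJ _ h3.1
            rw [h3.2] at this
            exact this rfl
          beta_reduce
          rw [if_neg h2, h1, if_pos ⟨hwE, rfl⟩]
          simp
        · simp only [hxv, if_false] at h
          have hxP := Finset.mem_of_mem_insert_of_ne hx hxv
          have h1 := hρ w x j hxP hwx h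
          have h2 := hπ w x j hxP hwx h
          simp only [h1]
          split_ifs
          · intro h3
            simp only [Bool.xor_left_inj] at h3
            exact h2 h3
          · exact h2
      · intro x hx
        by_cases hxv : x = v
        · subst hxv
          have : ((In x).filter fun w =>
              (if x = x then if w ∈ E then some (φ w) else none else lab w x) = none) =
              (In x).filter fun w => u ≤ (J w).card := by
            ext w
            have := hmemE w
            simp only [if_true, Finset.mem_filter]
            by_cases hw : w ∈ E
            · have := this.1 hw
              simp only [hw, if_true, reduceCtorEq, and_false, false_iff]
              omega
            · simp only [hw, if_false, and_true]
              rw [this] at hw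
              constructor
              · exact fun h => ⟨h, by by_contra; exact hw ⟨h, by omega⟩⟩
              · exact fun h => h.1
          rw [this, ← smul_eq_mul]
          refine (Finset.card_nsmul_le_sum _ (fun w => (J w).card) _
            fun w hw => (Finset.mem_filter.1 hw).2).trans ?_
          rw [← Finset.card_biUnion]
          · exact Finset.card_le_univ _
          · intro a _ b _ hab
            rw [Function.onFun, Finset.disjoint_left]
            intro j hj hj'
            rw [hJ] at hj hj'
            exact hab (hj.symm.trans hj')
        · simpa [hxv] using hspec x (Finset.mem_of_mem_insert_of_ne hx hxv)
      · intro w x j hx hwx h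
        by_cases hxv : x = v
        · subst hxv
          have hwE : w ∈ E := by
            by_contra hw
            simp [hw] at h
          simp only [if_true, hwE, Option.some.injEq] at h
          subst h
          have h1 := hφρ w hwE
          have h2 : ¬ (ρ (φ w) x ∈ E ∧ φ (ρ (φ w) x) = φ w) := fun h3 => by
            have := hφJ _ h3.1
            rw [h3.2] at this
            exact this rfl
          beta_reduce
          rw [if_neg h2, h1, if_pos ⟨hwE, rfl⟩]
        · simp only [hxv, if_false] at h
          simp only [hρ w x j (Finset.mem_of_mem_insert_of_ne hx hxv) hwx h]
      · intro w j h
        have h1 : ρ j w = w := hroot w j fun x hx hwx => by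
          simpa [hPv x hx] using h x (Finset.mem_insert_of_mem hx) hwx
        have h2 : ¬ (ρ j w ∈ E ∧ φ (ρ j w) = j) := fun h3 => by
          rw [h1] at h3
          refine h v (Finset.mem_insert_self v P) ((hmemE w).1 h3.1).1 ?_
          simp [h3.1, h3.2]
        beta_reduce
        rw [if_neg h2, h1]
  obtain ⟨lab, ρ, π, h1, h2, h3, h4, -, -⟩ := key Finset.univ
  exact ⟨lab, π, fun w v v' j => h1 w v v' j (Finset.mem_univ _) (Finset.mem_univ _),
    fun v j => h2 v j (Finset.mem_univ _), fun w v j => h3 w v j (Finset.mem_univ _),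
    fun v => h4 v (Finset.mem_univ _)⟩

theorem exists_degenerate_order {V : Type*} [Fintype V] [DecidableEq V] (M : SimpleGraph V)
    [DecidableRel M.Adj] (d : ℕ)
    (h : ∀ S : Finset V, S.Nonempty → ∃ v ∈ S, (S.filter fun w => M.Adj v w).card ≤ d) :
    ∃ ord : V → ℕ, Function.Injective ord ∧
      ∀ v, (Finset.univ.filter fun w => M.Adj v w ∧ ord w < ord v).card ≤ d := by
  have key : ∀ S : Finset V, ∃ ord : V → ℕ, Set.InjOn ord S ∧ (∀ v ∈ S, ord v < S.card) ∧
      ∀ v ∈ S, (S.filter fun w => M.Adj v w ∧ ord w < ord v).card ≤ d := by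
    intro S
    induction S using Finset.strongInduction with
    | H S ih =>
      obtain rfl | hS := S.eq_empty_or_nonempty
      · exact ⟨fun _ => 0, by simp⟩
      obtain ⟨v, hv, hvd⟩ := h S hS
      obtain ⟨ord, hinj, hlt, hd⟩ := ih (S.erase v) (Finset.erase_ssubset hv)
      have hcard := Finset.card_erase_add_one hv
      have hlt' : ∀ w ∈ S, w ≠ v → ord w < (S.erase v).card := fun w hw hwv =>
        hlt w (Finset.mem_erase.2 ⟨hwv, hw⟩)
      refine ⟨fun w => if w = v then (S.erase v).card else ord w, ?_, ?_, ?_⟩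
      · intro a ha b hb hab
        have ha' := hlt' a ha
        have hb' := hlt' b hb
        by_cases hav : a = v <;> by_cases hbv : b = v
        · rw [hav, hbv]
        · simp only [hav, hbv, if_true, if_false] at hab
          have := hb' hbv
          omega
        · simp only [hav, hbv, if_true, if_false] at hab
          have := ha' hav
          omega
        · simp only [hav, hbv, if_false] at hab
          exact hinj (by simp [hav, Finset.mem_coe.1 ha]) (by simp [hbv, Finset.mem_coe.1 hb]) hab
      · intro w hw
        have := hlt' w hw
        by_cases hwv : w = v
        · simp only [hwv, if_true]
          omega
        · have := this hwv
          simp only [hwv, if_false]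
          omega
      · intro w hw
        by_cases hwv : w = v
        · subst hwv
          refine (Finset.card_le_card fun x hx => ?_).trans hvd
          rw [Finset.mem_filter] at hx ⊢
          exact ⟨hx.1, hx.2.1⟩
        · refine (Finset.card_le_card fun x hx => ?_).trans
            (hd w (Finset.mem_erase.2 ⟨hwv, hw⟩))
          rw [Finset.mem_filter] at hx ⊢
          simp only [hwv, if_false] at hx
          by_cases hxv : x = v
          · have := hlt' w hw hwv
            simp only [hxv, if_true] at hx
            omega
          · simp only [hxv, if_false] at hx
            exact ⟨Finset.mem_erase.2 ⟨hxv, hx.1⟩, hx.2⟩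
  obtain ⟨ord, hinj, -, hd⟩ := key Finset.univ
  exact ⟨ord, by simpa [Set.injOn_univ] using hinj, fun v => hd v (Finset.mem_univ v)⟩

theorem exists_degenerate_order_of_indegree_le {V : Type*} [Fintype V] [DecidableEq V]
    (M : SimpleGraph V) [DecidableRel M.Adj] (s : ℕ) (In : V → Finset V)
    (hIn : ∀ v, (In v).card ≤ s) (hM : ∀ v w, M.Adj v w → w ∈ In v ∨ v ∈ In w) :
    ∃ ord : V → ℕ, Function.Injective ord ∧
      ∀ v, (Finset.univ.filter fun w => M.Adj v w ∧ ord w < ord v).card ≤ 2 * s := by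
  refine exists_degenerate_order M (2 * s) fun S hS => ?_
  by_contra! hlt
  have h1 : ∑ v ∈ S, (S.filter fun w => M.Adj v w).card ≤
      ∑ v ∈ S, (S.filter fun w => w ∈ In v).card + ∑ v ∈ S, (S.filter fun w => v ∈ In w).card := by
    rw [← Finset.sum_add_distrib]
    refine Finset.sum_le_sum fun v _ => (Finset.card_le_card ?_).trans (Finset.card_union_le _ _)
    intro w hw
    simp only [Finset.mem_filter, Finset.mem_union] at hw ⊢
    have := hM v w hw.2
    tauto
  have h2 : ∑ v ∈ S, (S.filter fun w => v ∈ In w).card =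
      ∑ v ∈ S, (S.filter fun w => w ∈ In v).card :=
    Finset.sum_card_bipartiteAbove_eq_sum_card_bipartiteBelow (fun v w => v ∈ In w)
  have h3 : ∑ v ∈ S, (S.filter fun w => w ∈ In v).card ≤ S.card * s := by
    rw [← smul_eq_mul]
    refine Finset.sum_le_card_nsmul _ _ _ fun v _ => le_trans (Finset.card_le_card ?_) (hIn v)
    intro w hw
    exact (Finset.mem_filter.1 hw).2
  have h4 : S.card * (2 * s + 1) ≤ ∑ v ∈ S, (S.filter fun w => M.Adj v w).card := by
    rw [← smul_eq_mul]
    exact Finset.card_nsmul_le_sum _ _ _ fun v hv => hlt v hv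
  have := hS.card_pos
  nlinarith

theorem exists_large_cut {V : Type*} [DecidableEq V] (M : SimpleGraph V) [DecidableRel M.Adj]
    (R : Finset V) : ∃ side : V → Bool, ((R ×ˢ R).filter fun e => M.Adj e.1 e.2).card ≤
      4 * ((R ×ˢ R).filter fun e => M.Adj e.1 e.2 ∧ side e.1 = false ∧ side e.2 = true).card := by
  induction R using Finset.induction_on with
  | empty => exact ⟨fun _ => true, by simp⟩
  | insert v R hv ih =>
    obtain ⟨side, hside⟩ := ih
    have hne : ∀ x ∈ R, x ≠ v := fun x hx h => hv (h ▸ hx)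
    have hexp : ∀ p : V → V → Prop, ∀ [DecidableRel p], ¬ p v v →
        (((insert v R) ×ˢ (insert v R)).filter fun e => p e.1 e.2).card =
        ((R ×ˢ R).filter fun e => p e.1 e.2).card + (R.filter fun x => p v x).card +
          (R.filter fun x => p x v).card := by
      intro p _ hp
      simp only [Finset.card_filter, Finset.sum_product, Finset.sum_insert hv, if_neg hp,
        Finset.sum_add_distrib]
      ring
    have hdeg : (R.filter fun x => M.Adj v x).card =
        (R.filter fun x => M.Adj v x ∧ side x = true).card +
        (R.filter fun x => M.Adj v x ∧ side x = false).card := by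
      rw [← Finset.card_filter_add_card_filter_not (s := R.filter fun x => M.Adj v x)
        (p := fun x => side x = true), Finset.filter_filter, Finset.filter_filter]
      simp
    have hsymm : (R.filter fun x => M.Adj x v).card = (R.filter fun x => M.Adj v x).card := by
      simp only [M.adj_comm]
    have hold : ∀ b, ((R ×ˢ R).filter fun e => M.Adj e.1 e.2 ∧
        Function.update side v b e.1 = false ∧ Function.update side v b e.2 = true) =
        ((R ×ˢ R).filter fun e => M.Adj e.1 e.2 ∧ side e.1 = false ∧ side e.2 = true) := by
      intro b
      refine Finset.filter_congr fun e he => ?_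
      rw [Finset.mem_product] at he
      rw [Function.update_of_ne (hne _ he.1), Function.update_of_ne (hne _ he.2)]
    by_cases hlt : (R.filter fun x => M.Adj v x ∧ side x = false).card ≤
        (R.filter fun x => M.Adj v x ∧ side x = true).card
    · refine ⟨Function.update side v false, ?_⟩
      rw [hexp (fun a b => M.Adj a b) (by simp), hsymm, hexp (fun a b => M.Adj a b ∧
        Function.update side v false a = false ∧ Function.update side v false b = true) (by simp),
        hold]
      have : (R.filter fun x => M.Adj v x ∧ Function.update side v false v = false ∧
          Function.update side v false x = true) =
          R.filter fun x => M.Adj v x ∧ side x = true := by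
        refine Finset.filter_congr fun x hx => ?_
        rw [Function.update_of_ne (hne _ hx)]
        simp
      rw [this]
      omega
    · refine ⟨Function.update side v true, ?_⟩
      rw [hexp (fun a b => M.Adj a b) (by simp), hsymm, hexp (fun a b => M.Adj a b ∧
        Function.update side v true a = false ∧ Function.update side v true b = true) (by simp),
        hold]
      have : (R.filter fun x => M.Adj x v ∧ Function.update side v true x = false ∧
          Function.update side v true v = true) =
          R.filter fun x => M.Adj v x ∧ side x = false := by
        refine Finset.filter_congr fun x hx => ?_
        rw [Function.update_of_ne (hne _ hx), M.adj_comm]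
        simp
      rw [this]
      omega

/-- Hakimi's theorem: a sparse graph has an orientation with bounded outdegrees. Here `In v`
is the set of tails of the arcs with head `v`. -/
theorem exists_orientation {V : Type*} [Fintype V] [DecidableEq V] (M : SimpleGraph V)
    [DecidableRel M.Adj] (D : ℕ) [NeZero D]
    (h : ∀ R : Finset V, ((R ×ˢ R).filter fun e => M.Adj e.1 e.2).card ≤ 2 * (D * R.card)) :
    ∃ In : V → Finset V, (∀ v w, M.Adj v w → w ∈ In v ∨ v ∈ In w) ∧
      (∀ v w, w ∈ In v → M.Adj v w) ∧ (∀ v w, w ∈ In v → v ∉ In w) ∧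
      ∀ w, (Finset.univ.filter fun v => w ∈ In v).card ≤ D := by
  let ord : V → ℕ := fun v => Fintype.equivFin V v
  have hord : ∀ {a b}, ord a = ord b → a = b := fun h =>
    (Fintype.equivFin V).injective (Fin.ext h)
  have hall := (Finset.all_card_le_biUnion_card_iff_exists_injective
    (fun e : {e : V × V // M.Adj e.1 e.2 ∧ ord e.1 < ord e.2} =>
      ({e.1.1, e.1.2} : Finset V) ×ˢ (Finset.univ : Finset (Fin D)))).1 (by
      intro S
      set R : Finset V := S.biUnion fun e => {e.1.1, e.1.2} with hR
      have h1 : (S.biUnion fun e => ({e.1.1, e.1.2} : Finset V) ×ˢ (Finset.univ : Finset (Fin D)))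
          = R ×ˢ Finset.univ := by
        ext x
        simp [hR]
      rw [h1, Finset.card_product, Finset.card_univ, Fintype.card_fin]
      have h2 := h R
      set S1 : Finset (V × V) := S.map (Function.Embedding.subtype _) with hS1
      have hS1' : ∀ e ∈ S1, M.Adj e.1 e.2 ∧ ord e.1 < ord e.2 ∧ e.1 ∈ R ∧ e.2 ∈ R := by
        intro e he
        simp only [hS1, Finset.mem_map, Function.Embedding.subtype_apply] at he
        obtain ⟨a, ha, rfl⟩ := he
        exact ⟨a.2.1, a.2.2, Finset.mem_biUnion.2 ⟨a, ha, by simp⟩,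
          Finset.mem_biUnion.2 ⟨a, ha, by simp⟩⟩
      set S2 : Finset (V × V) := S1.map (Equiv.prodComm V V).toEmbedding with hS2
      have hS2' : ∀ e ∈ S2, M.Adj e.1 e.2 ∧ ord e.2 < ord e.1 ∧ e.1 ∈ R ∧ e.2 ∈ R := by
        intro e he
        simp only [hS2, Finset.mem_map] at he
        obtain ⟨a, ha, rfl⟩ := he
        have := hS1' a ha
        exact ⟨this.1.symm, this.2.1, this.2.2.2, this.2.2.1⟩
      have hdisj : Disjoint S1 S2 := Finset.disjoint_left.2 fun e he he' => by
        have := hS1' e he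
        have := hS2' e he'
        omega
      have h3 : (S1 ∪ S2).card ≤ ((R ×ˢ R).filter fun e => M.Adj e.1 e.2).card := by
        refine Finset.card_le_card fun e he => ?_
        rw [Finset.mem_filter, Finset.mem_product]
        rcases Finset.mem_union.1 he with he | he
        · exact ⟨(hS1' e he).2.2, (hS1' e he).1⟩
        · exact ⟨(hS2' e he).2.2, (hS2' e he).1⟩
      rw [Finset.card_union_of_disjoint hdisj] at h3
      simp only [hS2, hS1, Finset.card_map] at h3
      rw [mul_comm]
      omega)
  obtain ⟨f, hf, hft⟩ := hall
  have hft' : ∀ e, (f e).1 = e.1.1 ∨ (f e).1 = e.1.2 := fun e => by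
    have := hft e
    simpa [Finset.mem_product] using this
  let F : V → V → V × Fin D := fun a b =>
    if h : M.Adj a b ∧ ord a < ord b then f ⟨(a, b), h⟩ else
      if h : M.Adj b a ∧ ord b < ord a then f ⟨(b, a), h⟩ else (a, 0)
  have hF1 : ∀ a b (h : M.Adj a b ∧ ord a < ord b), F a b = f ⟨(a, b), h⟩ := fun a b h => by
    simp only [F, dif_pos h]
  have hF2 : ∀ a b (h : M.Adj a b ∧ ord a < ord b), F b a = f ⟨(a, b), h⟩ := fun a b h => by
    have h' : ¬ (M.Adj b a ∧ ord b < ord a) := by omega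
    simp only [F, dif_pos h, dif_neg h']
  have hor : ∀ a b, M.Adj a b → ord a < ord b ∨ ord b < ord a := fun a b hab =>
    lt_or_gt_of_ne fun h => hab.ne (hord h)
  have hsymm : ∀ a b, M.Adj a b → F a b = F b a := by
    intro a b hab
    rcases hor a b hab with h | h
    · rw [hF1 a b ⟨hab, h⟩, hF2 a b ⟨hab, h⟩]
    · rw [hF1 b a ⟨hab.symm, h⟩, hF2 b a ⟨hab.symm, h⟩]
  have hmem : ∀ a b, M.Adj a b → (F a b).1 = a ∨ (F a b).1 = b := by
    intro a b hab
    rcases hor a b hab with h | h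
    · rw [hF1 a b ⟨hab, h⟩]
      exact hft' _
    · rw [hF2 b a ⟨hab.symm, h⟩]
      exact (hft' _).symm
  have hinj : ∀ a b b', M.Adj a b → M.Adj a b' → F a b = F a b' → b = b' := by
    intro a b b' hab hab' heq
    rcases hor a b hab with h | h <;> rcases hor a b' hab' with h' | h'
    · rw [hF1 a b ⟨hab, h⟩, hF1 a b' ⟨hab', h'⟩] at heq
      simpa using hf heq
    · rw [hF1 a b ⟨hab, h⟩, hF2 b' a ⟨hab'.symm, h'⟩] at heq
      have := hf heq
      simp only [Subtype.mk.injEq, Prod.mk.injEq] at this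
      exact this.2.trans this.1
    · rw [hF2 b a ⟨hab.symm, h⟩, hF1 a b' ⟨hab', h'⟩] at heq
      have := hf heq
      simp only [Subtype.mk.injEq, Prod.mk.injEq] at this
      exact this.1.trans this.2
    · rw [hF2 b a ⟨hab.symm, h⟩, hF2 b' a ⟨hab'.symm, h'⟩] at heq
      simpa using hf heq
  refine ⟨fun v => Finset.univ.filter fun w => M.Adj v w ∧ (F v w).1 = w, ?_, ?_, ?_, ?_⟩
  · intro v w hvw
    rcases hmem v w hvw with h | h
    · right
      rw [hsymm v w hvw] at h
      simp [hvw.symm, h]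
    · left
      simp [hvw, h]
  · intro v w hw
    exact (Finset.mem_filter.1 hw).2.1
  · intro v w hw hv
    simp only [Finset.mem_filter, Finset.mem_univ, true_and] at hw hv
    rw [hsymm v w hw.1, hv.2] at hw
    exact hw.1.ne hw.2
  · intro w
    have : (Finset.univ.filter fun v =>
        w ∈ Finset.univ.filter fun w => M.Adj v w ∧ (F v w).1 = w).card ≤
        (Finset.univ : Finset (Fin D)).card := by
      refine Finset.card_le_card_of_injOn (fun v => (F w v).2) (fun _ _ => Finset.mem_univ _) ?_
      intro v hv v' hv' heq
      simp only [Finset.coe_filter, Finset.mem_filter, Finset.mem_univ, true_and,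
        Set.mem_ofPred_eq] at hv hv'
      rw [hsymm v w hv.1] at hv
      rw [hsymm v' w hv'.1] at hv'
      exact hinj w v v' hv.1.symm hv'.1.symm (Prod.ext (hv.2.trans hv'.2.symm) heq)
    simpa using this

/-- A family of fewer than `|E| / (p - 1)` sets has a common nonempty `F ⊆ E` meeting each of them
in a multiple of `p` elements. -/
theorem exists_nonempty_subset_prime_dvd {ι κ : Type*} [DecidableEq ι] {p : ℕ} (hp : p.Prime)
    (E : Finset ι) (t : Finset κ) (A : κ → ι → Prop) [∀ a, DecidablePred (A a)]
    (h : t.card * (p - 1) < E.card) :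
    ∃ F ⊆ E, F.Nonempty ∧ ∀ a ∈ t, p ∣ (F.filter (A a)).card := by
  have : Fact p.Prime := ⟨hp⟩
  let f : κ → MvPolynomial {e // e ∈ E} (ZMod p) := fun a =>
    ∑ e ∈ Finset.univ.filter fun e : {e // e ∈ E} => A a e, MvPolynomial.X e ^ (p - 1)
  have heval : ∀ a x, MvPolynomial.eval x (f a) =
      ((Finset.univ.filter fun e : {e // e ∈ E} => A a e ∧ x e ≠ 0).card : ZMod p) := by
    intro a x
    simp only [f, map_sum, map_pow, MvPolynomial.eval_X, ZMod.pow_card_sub_one]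
    rw [Finset.sum_ite, Finset.sum_const_zero, add_zero, Finset.filter_filter]
    simp
  have hdeg : ∑ a ∈ t, (f a).totalDegree < Fintype.card {e // e ∈ E} := by
    rw [Fintype.card_coe]
    refine lt_of_le_of_lt ?_ h
    rw [← smul_eq_mul]
    refine Finset.sum_le_card_nsmul _ _ _ fun a _ => ?_
    refine (MvPolynomial.totalDegree_finsetSum _ _).trans (Finset.sup_le fun e _ => ?_)
    rw [MvPolynomial.totalDegree_X_pow]
  have hdvd := char_dvd_card_solutions_of_sum_lt p hdeg
  have h0 : ∀ a ∈ t, MvPolynomial.eval 0 (f a) = 0 := fun a _ => by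
    rw [heval]
    simp
  have hgt := Nat.le_of_dvd (Fintype.card_pos_iff.2 ⟨⟨0, h0⟩⟩) hdvd
  obtain ⟨x, hx⟩ := Fintype.exists_ne_of_one_lt_card (lt_of_lt_of_le hp.one_lt hgt) ⟨0, h0⟩
  have hx0 : ∃ e, x.1 e ≠ 0 := by
    by_contra! hall
    exact hx (Subtype.ext (funext hall))
  obtain ⟨e, he⟩ := hx0
  refine ⟨(Finset.univ.filter fun e => x.1 e ≠ 0).map (Function.Embedding.subtype _), ?_,
    ⟨e.1, ?_⟩, fun a ha => ?_⟩
  · intro e he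
    simp only [Finset.mem_map, Function.Embedding.subtype_apply] at he
    obtain ⟨a, -, rfl⟩ := he
    exact a.2
  · exact Finset.mem_map_of_mem _ (by simpa using he)
  · have := x.2 a ha
    rw [heval, ZMod.natCast_eq_zero_iff] at this
    rw [Finset.filter_map, Finset.card_map, Finset.filter_filter]
    rwa [Finset.filter_congr fun e _ => and_comm]

theorem card_fiber_mul_of_grouping {ι κ : Type*} [DecidableEq κ] {d : ℕ} {F T : Finset ι}
    (hTF : T ⊆ F) {l : ι → κ}
    {g : ι → ℕ}
    (h : ∀ x : κ × ℕ, (T.filter fun e => (l e, g e) = x).card * d =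
      (F.filter fun e => (l e, g e) = x).card) (v : κ) :
    (T.filter (l · = v)).card * d = (F.filter (l · = v)).card := by
  have key : ∀ S ⊆ F, (S.filter (l · = v)).card = ∑ x ∈ (F.image fun e => (l e, g e)).filter
      (·.1 = v), (S.filter fun e => (l e, g e) = x).card := by
    intro S hS
    rw [Finset.card_eq_sum_card_fiberwise (f := fun e => (l e, g e))
      (t := (F.image fun e => (l e, g e)).filter (·.1 = v))]
    · refine Finset.sum_congr rfl fun x hx => ?_
      rw [Finset.filter_filter]
      congr 1
      refine Finset.filter_congr fun e _ => ⟨fun h => h.2, fun h => ⟨?_, h⟩⟩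
      rw [← (Finset.mem_filter.1 hx).2, ← h]
    · intro e he
      have he := Finset.mem_filter.1 he
      refine Finset.mem_coe.2 (Finset.mem_filter.2 ⟨Finset.mem_image_of_mem _ (hS he.1), he.2⟩)
  rw [key T hTF, key F Finset.Subset.rfl, Finset.sum_mul]
  exact Finset.sum_congr rfl fun x _ => h x

section Peeling

variable {ι κ κ' : Type*} [DecidableEq ι] [DecidableEq κ] [DecidableEq κ']

/-- A regular bipartite multigraph, given by the endpoint maps of its edges, has a perfect
matching. -/
theorem exists_transversal {F : Finset ι} {l : ι → κ} {r : ι → κ'} {d : ℕ} (hd : 0 < d)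
    (hl : ∀ x, (F.filter (l · = x)).card = 0 ∨ (F.filter (l · = x)).card = d)
    (hr : ∀ y, (F.filter (r · = y)).card = 0 ∨ (F.filter (r · = y)).card = d) :
    ∃ T ⊆ F, (∀ x, (T.filter (l · = x)).card * d = (F.filter (l · = x)).card) ∧
      ∀ y, (T.filter (r · = y)).card * d = (F.filter (r · = y)).card := by
  have hl' : ∀ x ∈ F.image l, (F.filter (l · = x)).card = d := by
    intro x hx
    obtain ⟨e, he, rfl⟩ := Finset.mem_image.1 hx
    exact (hl _).resolve_left (Finset.card_ne_zero.2 ⟨e, by simp [he]⟩)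
  have hr' : ∀ x ∈ F.image r, (F.filter (r · = x)).card = d := by
    intro x hx
    obtain ⟨e, he, rfl⟩ := Finset.mem_image.1 hx
    exact (hr _).resolve_left (Finset.card_ne_zero.2 ⟨e, by simp [he]⟩)
  have hall := (Finset.all_card_le_biUnion_card_iff_exists_injective
    (fun x : {x // x ∈ F.image l} => (F.filter (l · = x)).image r)).1 (by
      intro S
      refine Nat.le_of_mul_le_mul_right ?_ hd
      set Y := S.biUnion fun x => (F.filter (l · = x)).image r with hY
      have h1 : S.card * d = (F.filter fun e => ∃ x ∈ S, x.1 = l e).card := by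
        rw [← smul_eq_mul, ← Finset.sum_const, Finset.card_eq_sum_card_fiberwise
          (f := l) (t := S.map (Function.Embedding.subtype _)), Finset.sum_map]
        · refine Finset.sum_congr rfl fun x hx => ?_
          rw [← hl' x.1 x.2, Finset.filter_filter]
          congr 1
          refine Finset.filter_congr fun e _ => ?_
          simp only [Function.Embedding.subtype_apply]
          exact ⟨fun h => ⟨⟨x, hx, h.symm⟩, h⟩, fun h => h.2⟩
        · intro e he
          simp only [Finset.coe_filter, Set.mem_ofPred_eq] at he
          obtain ⟨-, x, hx, hxe⟩ := he
          simp only [Finset.coe_map, Set.mem_image, Finset.mem_coe]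
          exact ⟨x, hx, hxe⟩
      have h2 : (F.filter fun e => r e ∈ Y).card ≤ Y.card * d := by
        rw [← smul_eq_mul, Finset.card_eq_sum_card_fiberwise (f := r) (t := Y)]
        · refine Finset.sum_le_card_nsmul _ _ _ fun y _ => ?_
          refine (Finset.card_le_card (Finset.filter_subset_filter _
            (Finset.filter_subset _ _))).trans ?_
          rcases hr y with h | h <;> omega
        · intro e he
          simpa using (Finset.mem_filter.1 he).2
      rw [h1]
      refine (Finset.card_le_card fun e he => ?_).trans h2
      rw [Finset.mem_filter] at he ⊢
      obtain ⟨he, x, hx, hxe⟩ := he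
      exact ⟨he, Finset.mem_biUnion.2 ⟨x, hx, Finset.mem_image_of_mem _ (by simp [he, hxe])⟩⟩)
  obtain ⟨h, hinj, hh⟩ := hall
  have hch : ∀ x : {x // x ∈ F.image l}, ∃ e ∈ F, l e = x ∧ r e = h x := fun x => by
    have := hh x
    simp only [Finset.mem_image, Finset.mem_filter] at this
    obtain ⟨e, ⟨he, hle⟩, hre⟩ := this
    exact ⟨e, he, hle, hre⟩
  choose g hgF hgl hgr using hch
  have hcardl : F.card = (F.image l).card * d := by
    rw [Finset.card_eq_sum_card_image l F, Finset.sum_congr rfl hl', Finset.sum_const, smul_eq_mul]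
  have hcardr : F.card = (F.image r).card * d := by
    rw [Finset.card_eq_sum_card_image r F, Finset.sum_congr rfl hr', Finset.sum_const, smul_eq_mul]
  have himg : Finset.univ.image h = F.image r := by
    refine Finset.eq_of_subset_of_card_le ?_ ?_
    · intro y hy
      obtain ⟨x, -, rfl⟩ := Finset.mem_image.1 hy
      rw [← hgr x]
      exact Finset.mem_image_of_mem _ (hgF x)
    · rw [Finset.card_image_of_injective _ hinj, Finset.card_univ, Fintype.card_coe]
      refine (Nat.le_of_mul_le_mul_right ?_ hd)
      omega
  refine ⟨Finset.univ.image g, ?_, fun x => ?_, fun y => ?_⟩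
  · intro e he
    obtain ⟨x, -, rfl⟩ := Finset.mem_image.1 he
    exact hgF x
  · by_cases hx : x ∈ F.image l
    · rw [hl' x hx]
      have : (Finset.univ.image g).filter (l · = x) = {g ⟨x, hx⟩} := by
        ext e
        simp only [Finset.mem_filter, Finset.mem_image, Finset.mem_univ, true_and,
          Finset.mem_singleton]
        constructor
        · rintro ⟨⟨z, rfl⟩, hz⟩
          rw [hgl] at hz
          subst hz
          rfl
        · rintro rfl
          exact ⟨⟨_, rfl⟩, hgl _⟩
      rw [this, Finset.card_singleton, one_mul]
    · have h1 : F.filter (l · = x) = ∅ := Finset.filter_eq_empty_iff.2 fun e he hex =>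
        hx (hex ▸ Finset.mem_image_of_mem _ he)
      have h2 : (Finset.univ.image g).filter (l · = x) = ∅ :=
        Finset.filter_eq_empty_iff.2 fun e he hex => by
          obtain ⟨z, -, rfl⟩ := Finset.mem_image.1 he
          exact hx (hex ▸ Finset.mem_image_of_mem _ (hgF z))
      rw [h1, h2, Finset.card_empty, zero_mul]
  · by_cases hy : y ∈ F.image r
    · rw [hr' y hy]
      rw [← himg] at hy
      obtain ⟨x, -, rfl⟩ := Finset.mem_image.1 hy
      have : (Finset.univ.image g).filter (r · = h x) = {g x} := by
        ext e
        simp only [Finset.mem_filter, Finset.mem_image, Finset.mem_univ, true_and,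
          Finset.mem_singleton]
        constructor
        · rintro ⟨⟨z, rfl⟩, hz⟩
          rw [hgr] at hz
          rw [hinj hz]
        · rintro rfl
          exact ⟨⟨_, rfl⟩, hgr _⟩
      rw [this, Finset.card_singleton, one_mul]
    · have h1 : F.filter (r · = y) = ∅ := Finset.filter_eq_empty_iff.2 fun e he hex =>
        hy (hex ▸ Finset.mem_image_of_mem _ he)
      have h2 : (Finset.univ.image g).filter (r · = y) = ∅ :=
        Finset.filter_eq_empty_iff.2 fun e he hex => by
          obtain ⟨z, -, rfl⟩ := Finset.mem_image.1 he
          exact hy (hex ▸ Finset.mem_image_of_mem _ (hgF z))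
      rw [h1, h2, Finset.card_empty, zero_mul]

theorem exists_grouping {d m : ℕ} (s : Finset ι) (hs : s.card = m * d) :
    ∃ g : ι → ℕ, ∀ i, (s.filter (g · = i)).card = 0 ∨ (s.filter (g · = i)).card = d := by
  suffices ∃ g : ι → ℕ, (∀ e ∈ s, g e < m) ∧
      ∀ i, (s.filter (g · = i)).card = 0 ∨ (s.filter (g · = i)).card = d from
    this.imp fun _ h => h.2
  induction m generalizing s with
  | zero =>
    rw [zero_mul, Finset.card_eq_zero] at hs
    exact ⟨fun _ => 0, by simp [hs]⟩
  | succ m ih =>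
    obtain ⟨a, ha, had⟩ := Finset.exists_subset_card_eq (s := s) (n := d)
      (by rw [hs]; exact Nat.le_mul_of_pos_left _ (by omega))
    obtain ⟨g, hgm, hg⟩ := ih (s \ a) (by
      have := Finset.card_sdiff_add_card_eq_card ha
      rw [hs, had, add_mul] at this
      omega)
    refine ⟨fun e => if e ∈ a then m else g e, fun e he => ?_, fun i => ?_⟩
    · by_cases hea : e ∈ a
      · simp [hea]
      · have := hgm e (Finset.mem_sdiff.2 ⟨he, hea⟩)
        simp only [hea, if_false]
        omega
    · by_cases him : i = m
      · right
        rw [← had]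
        congr 1
        ext e
        rw [Finset.mem_filter]
        by_cases hea : e ∈ a
        · simp [hea, him, ha hea]
        · simp only [hea, if_false, iff_false, not_and]
          intro he
          have := hgm e (Finset.mem_sdiff.2 ⟨he, hea⟩)
          omega
      · have : s.filter (fun e => (if e ∈ a then m else g e) = i) = (s \ a).filter (g · = i) := by
          ext e
          simp only [Finset.mem_filter, Finset.mem_sdiff]
          by_cases hea : e ∈ a <;> simp [hea, Ne.symm him]
        rw [this]
        exact hg i

theorem exists_fiberwise_grouping {d : ℕ} {F : Finset ι} {l : ι → κ}
    (hl : ∀ v, d ∣ (F.filter (l · = v)).card) :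
    ∃ g : ι → ℕ, ∀ x : κ × ℕ, (F.filter fun e => (l e, g e) = x).card = 0 ∨
      (F.filter fun e => (l e, g e) = x).card = d := by
  have h : ∀ v, ∃ g : ι → ℕ, ∀ i, ((F.filter (l · = v)).filter (g · = i)).card = 0 ∨
      ((F.filter (l · = v)).filter (g · = i)).card = d := fun v => by
    obtain ⟨m, hm⟩ := hl v
    exact exists_grouping (m := m) _ (by rw [hm, mul_comm])
  choose g hg using h
  refine ⟨fun e => g (l e) e, fun x => ?_⟩
  have : (F.filter fun e => (l e, g (l e) e) = x) =
      (F.filter (l · = x.1)).filter (g x.1 · = x.2) := by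
    ext e
    simp only [Finset.mem_filter, Prod.ext_iff]
    constructor
    · rintro ⟨he, h1, h2⟩
      exact ⟨⟨he, h1⟩, h1 ▸ h2⟩
    · rintro ⟨⟨he, h1⟩, h2⟩
      exact ⟨he, h1, h1.symm ▸ h2⟩
  rw [this]
  exact hg x.1 x.2

theorem exists_nonempty_subset_dvd_pred {F : Finset ι} {l : ι → κ} {r : ι → κ'} {q : ℕ}
    (hq : 0 < q) (hF : F.Nonempty) (hl : ∀ v, q + 1 ∣ (F.filter (l · = v)).card)
    (hr : ∀ v, q + 1 ∣ (F.filter (r · = v)).card) :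
    ∃ F' ⊆ F, F'.Nonempty ∧ (∀ v, q ∣ (F'.filter (l · = v)).card) ∧
      ∀ v, q ∣ (F'.filter (r · = v)).card := by
  obtain ⟨gl, hgl⟩ := exists_fiberwise_grouping hl
  obtain ⟨gr, hgr⟩ := exists_fiberwise_grouping hr
  obtain ⟨T, hTF, hTl, hTr⟩ := exists_transversal (Nat.succ_pos q) hgl hgr
  have hTl' := card_fiber_mul_of_grouping hTF hTl
  have hTr' := card_fiber_mul_of_grouping hTF hTr
  have hsub : ∀ (P : ι → Prop) [DecidablePred P],
      (T.filter P).card * (q + 1) = (F.filter P).card →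
      ((F \ T).filter P).card = (T.filter P).card * q := by
    intro P _ h
    have h1 : (F \ T).filter P = F.filter P \ T.filter P := by
      ext e
      simp only [Finset.mem_filter, Finset.mem_sdiff]
      tauto
    have h2 := Finset.card_sdiff_add_card_eq_card (Finset.filter_subset_filter P hTF)
    rw [h1]
    rw [mul_add, mul_one] at h
    omega
  obtain ⟨e, he⟩ := hF
  refine ⟨F \ T, Finset.sdiff_subset, ?_, fun v => ?_, fun v => ?_⟩
  · have h1 : 0 < (F.filter (l · = l e)).card := Finset.card_pos.2 ⟨e, by simp [he]⟩
    rw [← hTl'] at h1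
    have h2 : 0 < ((F \ T).filter (l · = l e)).card := by
      rw [hsub _ (hTl' _)]
      exact Nat.mul_pos (Nat.pos_of_mul_pos_right h1) hq
    obtain ⟨a, ha⟩ := Finset.card_pos.1 h2
    exact ⟨a, (Finset.mem_filter.1 ha).1⟩
  · exact ⟨_, (hsub _ (hTl' v)).trans (mul_comm _ _)⟩
  · exact ⟨_, (hsub _ (hTr' v)).trans (mul_comm _ _)⟩

/-- A bipartite multigraph with more than `(p - 1) n` edges on `n` vertices has a nonempty
subgraph all of whose degrees are divisible by `k`, for every `k ≤ p`. -/
theorem exists_nonempty_subset_dvd {E : Finset ι} {l : ι → κ} {r : ι → κ'} {p k : ℕ}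
    (hp : p.Prime) (hk : 0 < k) (hkp : k ≤ p) {R : Finset κ} {R' : Finset κ'}
    (hl : ∀ e ∈ E, l e ∈ R) (hr : ∀ e ∈ E, r e ∈ R')
    (hE : (R.card + R'.card) * (p - 1) < E.card) :
    ∃ F ⊆ E, F.Nonempty ∧ (∀ v, k ∣ (F.filter (l · = v)).card) ∧
      ∀ v, k ∣ (F.filter (r · = v)).card := by
  have hprime : ∃ F ⊆ E, F.Nonempty ∧ (∀ v, p ∣ (F.filter (l · = v)).card) ∧
      ∀ v, p ∣ (F.filter (r · = v)).card := by
    obtain ⟨F, hFE, hF, h⟩ := exists_nonempty_subset_prime_dvd hp E (R.disjSum R')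
      (fun a e => Sum.inl (l e) = a ∨ Sum.inr (r e) = a) (by rwa [Finset.card_disjSum])
    refine ⟨F, hFE, hF, fun v => ?_, fun v => ?_⟩
    · by_cases hv : v ∈ R
      · simpa using h (Sum.inl v) (by simpa using hv)
      · have : F.filter (l · = v) = ∅ :=
          Finset.filter_eq_empty_iff.2 fun e he hev => hv (hev ▸ hl e (hFE he))
        simp [this]
    · by_cases hv : v ∈ R'
      · simpa using h (Sum.inr v) (by simpa using hv)
      · have : F.filter (r · = v) = ∅ :=
          Finset.filter_eq_empty_iff.2 fun e he hev => hv (hev ▸ hr e (hFE he))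
        simp [this]
  induction hkp using Nat.decreasingInduction with
  | self => exact hprime
  | of_succ q _ ih =>
    obtain ⟨F, hFE, hF, hFl, hFr⟩ := ih (by omega)
    obtain ⟨F', hF'F, hF', hl', hr'⟩ := exists_nonempty_subset_dvd_pred hk hF hFl hFr
    exact ⟨F', hF'F.trans hFE, hF', hl', hr'⟩

end Peeling

/-- Each vertex of `H` has degree zero or congruent to `1` modulo `k`. -/
def SimpleGraph.DegreesModEqOne {V : Type*} (k : ℕ) (H : SimpleGraph V) : Prop :=
  ∀ v, {w | H.Adj v w}.ncard = 0 ∨ {w | H.Adj v w}.ncard % k = 1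

section Maximal

open Classical

variable {V : Type*} [Fintype V] {k : ℕ} {G H : SimpleGraph V}

theorem SimpleGraph.DegreesModEqOne.sup_maximal
    (hH : Maximal (fun H => H ≤ G ∧ H.DegreesModEqOne k) H) {X : SimpleGraph V} (hXG : X ≤ G)
    (hXH : ∀ v w, X.Adj v w → ¬H.Adj v w)
    (hX : ∀ v, {w | X.Adj v w}.ncard = 0 ∨
      {w | H.Adj v w}.ncard = 0 ∧
        {w | X.Adj v w}.ncard % k = 1 ∨
      {w | H.Adj v w}.ncard ≠ 0 ∧
        k ∣ {w | X.Adj v w}.ncard) (v w : V) : ¬X.Adj v w := by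
  intro hvw
  refine hXH v w hvw (hH.2 ⟨sup_le hH.1.1 hXG, fun a => ?_⟩ le_sup_left (Or.inr hvw))
  have h1 : {w | (H ⊔ X).Adj a w}.ncard =
      {w | H.Adj a w}.ncard +
      {w | X.Adj a w}.ncard := by
    rw [← Set.ncard_union_eq]
    · rfl
    · exact Set.disjoint_left.2 fun b hb hb' => hXH a b hb' hb
  rw [h1]
  rcases hX a with h | ⟨h, h'⟩ | ⟨h, m, h'⟩
  · rw [h, add_zero]
    exact hH.1.2 a
  · rw [h, zero_add]
    exact Or.inr h'
  · rw [h', Nat.add_mul_mod_self_left]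
    exact Or.inr ((hH.1.2 a).resolve_left h)

theorem SimpleGraph.DegreesModEqOne.not_adj_of_maximal (hk : 2 ≤ k)
    (hH : Maximal (fun H => H ≤ G ∧ H.DegreesModEqOne k) H) {v w : V}
    (hv : ∀ x, ¬H.Adj v x) (hw : ∀ x, ¬H.Adj w x) : ¬G.Adj v w := by
  intro hvw
  have hne := hvw.ne
  refine sup_maximal hH (X := SimpleGraph.edge v w) ?_ ?_ ?_ v w ?_
  · exact (SimpleGraph.edge_le_iff G).2 (Or.inr hvw)
  · intro a b hab hab'
    rw [SimpleGraph.edge_adj] at hab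
    rcases hab.1 with ⟨rfl, rfl⟩ | ⟨rfl, rfl⟩
    · exact hv _ hab'
    · exact hw _ hab'
  · intro a
    simp only [SimpleGraph.edge_adj]
    by_cases hav : a = v
    · subst hav
      right; left
      refine ⟨by simp [hv], ?_⟩
      rw [show {x | (a = a ∧ x = w ∨ a = w ∧ x = a) ∧ a ≠ x} = {w} by
        ext x; simp; grind]
      simpa using Nat.mod_eq_of_lt hk
    by_cases haw : a = w
    · subst haw
      right; left
      refine ⟨by simp [hw], ?_⟩
      rw [show {x | (a = v ∧ x = a ∨ a = a ∧ x = v) ∧ a ≠ x} = {v} by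
        ext x; simp; grind]
      simpa using Nat.mod_eq_of_lt hk
    · left
      simp [hav, haw]
  · simpa [SimpleGraph.edge_adj] using hne

theorem SimpleGraph.DegreesModEqOne.card_lt_of_maximal (hk : 2 ≤ k)
    (hH : Maximal (fun H => H ≤ G ∧ H.DegreesModEqOne k) H) {v x : V} (hvx : H.Adj v x) :
    {w | G.Adj v w ∧ ∀ y, ¬H.Adj w y}.ncard < k := by
  by_contra! h
  rw [Set.ncard_eq_toFinset_card'] at h
  obtain ⟨S, hS, hSk⟩ := Finset.exists_subset_card_eq h
  have hS' : ∀ w ∈ S, G.Adj v w ∧ ∀ y, ¬H.Adj w y := fun w hw => by simpa using hS hw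
  have hvS : v ∉ S := fun hv => (hS' v hv).2 x hvx
  obtain ⟨s, hs⟩ : S.Nonempty := Finset.card_pos.1 (by omega)
  let X : SimpleGraph V :=
    { Adj := fun a b => a = v ∧ b ∈ S ∨ b = v ∧ a ∈ S
      symm := ⟨fun a b h => h.symm⟩
      loopless := ⟨fun a h' => by rcases h' with ⟨rfl, h'⟩ | ⟨rfl, h'⟩ <;> exact hvS h'⟩ }
  refine sup_maximal hH (X := X) ?_ ?_ ?_ v s (Or.inl ⟨rfl, hs⟩)
  · rintro a b (⟨rfl, h'⟩ | ⟨rfl, h'⟩)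
    · exact (hS' _ h').1
    · exact (hS' _ h').1.symm
  · rintro a b (⟨rfl, h'⟩ | ⟨rfl, h'⟩) hab
    · exact (hS' _ h').2 _ hab.symm
    · exact (hS' _ h').2 _ hab
  · intro a
    by_cases hav : a = v
    · subst hav
      right; right
      rw [show {w | X.Adj a w} = ↑S by ext; simp [X]; grind, Set.ncard_coe_finset, hSk]
      exact ⟨Set.ncard_ne_zero_of_mem (a := x) hvx, dvd_rfl⟩
    by_cases haS : a ∈ S
    · right; left
      rw [show {w | X.Adj a w} = {v} by ext; simp [X]; grind]
      exact ⟨by simp [(hS' a haS).2], by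
        simpa using Nat.mod_eq_of_lt hk⟩
    · left
      simp [X, hav, haS]

theorem SimpleGraph.DegreesModEqOne.card_adj_le_of_maximal (hk : 2 ≤ k) {p : ℕ} (hp : p.Prime)
    (hkp : k ≤ p) (hH : Maximal (fun H => H ≤ G ∧ H.DegreesModEqOne k) H) (R : Finset V)
    (hR : ∀ v ∈ R, ∃ x, H.Adj v x) :
    ((R ×ˢ R).filter fun e => (G \ H).Adj e.1 e.2).card ≤ 2 * (2 * (p - 1) * R.card) := by
  obtain ⟨side, hside⟩ := exists_large_cut (G \ H) R
  refine hside.trans ?_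
  set E := (R ×ˢ R).filter fun e => (G \ H).Adj e.1 e.2 ∧ side e.1 = false ∧ side e.2 = true
    with hE
  suffices E.card ≤ R.card * (p - 1) by linarith
  by_contra! hlt
  have hcard : (R.filter fun v => side v = false).card + (R.filter fun v => side v = true).card =
      R.card := by
    rw [← Finset.card_filter_add_card_filter_not (s := R) (fun v => side v = false)]
    simp
  obtain ⟨F, hFE, ⟨e, he⟩, hF1, hF2⟩ := exists_nonempty_subset_dvd (E := E) (l := Prod.fst)
    (r := Prod.snd) hp (by omega : 0 < k) hkp (R := R.filter fun v => side v = false)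
    (R' := R.filter fun v => side v = true) (by simp +contextual [hE])
    (by simp +contextual [hE]) (by rwa [hcard])
  have hF : ∀ e ∈ F, e.1 ∈ R ∧ e.2 ∈ R ∧ (G \ H).Adj e.1 e.2 ∧ side e.1 = false ∧
      side e.2 = true := fun e he => by simpa [hE, and_assoc] using hFE he
  let X : SimpleGraph V :=
    { Adj := fun a b => (a, b) ∈ F ∨ (b, a) ∈ F
      symm := ⟨fun a b h => h.symm⟩
      loopless := ⟨fun a h => by
        have h := hF _ (h.elim id id)
        exact h.2.2.1.ne rfl⟩ }
  have hXGH : ∀ a b, X.Adj a b → (G \ H).Adj a b := by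
    rintro a b (h | h)
    · exact (hF _ h).2.2.1
    · exact (hF _ h).2.2.1.symm
  refine sup_maximal hH (X := X) (fun a b h => (hXGH a b h).1) (fun a b h => (hXGH a b h).2) ?_
    e.1 e.2 (Or.inl he)
  intro a
  by_cases ha : a ∈ R
  · right; right
    refine ⟨(hR a ha).elim fun x hx => Set.ncard_ne_zero_of_mem (a := x) hx, ?_⟩
    rw [Set.ncard_eq_toFinset_card']
    cases hs : side a
    · convert hF1 a using 1
      refine Finset.card_bij (fun b _ => (a, b)) ?_ (by simp) ?_
      · intro b hb
        rcases Set.mem_toFinset.1 hb with h | h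
        · simpa using h
        · exact absurd (hF _ h).2.2.2.2 (by simp [hs])
      · rintro ⟨c, b⟩ hb
        obtain ⟨hbF, rfl⟩ := Finset.mem_filter.1 hb
        exact ⟨b, Set.mem_toFinset.2 (Or.inl hbF), rfl⟩
    · convert hF2 a using 1
      refine Finset.card_bij (fun b _ => (b, a)) ?_ (by simp) ?_
      · intro b hb
        rcases Set.mem_toFinset.1 hb with h | h
        · exact absurd (hF _ h).2.2.2.1 (by simp [hs])
        · simpa using h
      · rintro ⟨b, c⟩ hb
        obtain ⟨hbF, rfl⟩ := Finset.mem_filter.1 hb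
        exact ⟨b, Set.mem_toFinset.2 (Or.inr hbF), rfl⟩
  · left
    rw [Set.ncard_eq_zero, Set.eq_empty_iff_forall_notMem]
    rintro b (h | h)
    · exact ha (hF _ h).1
    · exact ha (hF _ h).2.1

/-- Structure of the complement of an edge-maximal subgraph with all degrees zero or `1` modulo
`k`: the vertices it misses are independent, every other vertex sees fewer than `k` of them, and
the remaining edges between covered vertices can be oriented with bounded outdegree. -/
theorem SimpleGraph.exists_degreesModEqOne_structure (hk : 2 ≤ k) {p : ℕ} (hp : p.Prime)
    (hkp : k ≤ p) (G : SimpleGraph V) :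
    ∃ (H : SimpleGraph V) (W : V → Prop) (In : V → Finset V), H ≤ G ∧ H.DegreesModEqOne k ∧
      (∀ v w, H.Adj v w → ¬W v) ∧ (∀ v w, W v → W w → ¬G.Adj v w) ∧
      (∀ v, ¬W v → {w | G.Adj v w ∧ W w}.ncard < k) ∧
      (∀ v w, ¬W v → ¬W w → G.Adj v w → ¬H.Adj v w → w ∈ In v ∨ v ∈ In w) ∧
      (∀ v w, w ∈ In v → G.Adj v w ∧ ¬H.Adj v w ∧ ¬W v ∧ ¬W w ∧ v ∉ In w) ∧
      ∀ w, (Finset.univ.filter fun v => w ∈ In v).card ≤ 2 * (p - 1) := by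
  obtain ⟨H, -, hH⟩ := (Set.toFinite
    {H : SimpleGraph V | H ≤ G ∧ H.DegreesModEqOne k}).exists_le_maximal
    (a := ⊥) ⟨bot_le, fun v => Or.inl (by simp)⟩
  replace hH : Maximal (fun H => H ≤ G ∧ H.DegreesModEqOne k) H := hH
  let W : V → Prop := fun v => ∀ x, ¬H.Adj v x
  let M : SimpleGraph V :=
    { Adj := fun a b => (G \ H).Adj a b ∧ ¬W a ∧ ¬W b
      symm := ⟨fun a b h => ⟨h.1.symm, h.2.2, h.2.1⟩⟩
      loopless := ⟨fun a h => h.1.ne rfl⟩ }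
  have : NeZero (2 * (p - 1)) := ⟨by have := hp.two_le; omega⟩
  obtain ⟨In, h1, h2, h3, h4⟩ := exists_orientation M (2 * (p - 1)) (by
    intro R
    refine le_trans ?_ ((DegreesModEqOne.card_adj_le_of_maximal hk hp hkp hH
      (R.filter fun v => ¬W v) ?_).trans ?_)
    · refine Finset.card_le_card fun e he => ?_
      simp only [Finset.mem_filter, Finset.mem_product, M] at he ⊢
      tauto
    · intro v hv
      simpa [W] using (Finset.mem_filter.1 hv).2
    · gcongr
      exact Finset.filter_subset _ _)
  refine ⟨H, W, In, hH.1.1, hH.1.2, fun v w h h' => h' w h,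
    fun v w hv hw => DegreesModEqOne.not_adj_of_maximal hk hH hv hw, fun v hv => ?_,
    fun v w hv hw hG hHa => h1 v w ⟨⟨hG, hHa⟩, hv, hw⟩, fun v w h => ?_, h4⟩
  · simp only [W, not_forall, not_not] at hv
    obtain ⟨x, hx⟩ := hv
    exact DegreesModEqOne.card_lt_of_maximal hk hH hx
  · obtain ⟨⟨hG, hHa⟩, hv, hw⟩ := h2 v w h
    exact ⟨hG, hHa, hv, hw, h3 v w h⟩

end Maximal

/-- Colouring the edges of a graph with an orientation of bounded outdegree. -/
theorem exists_coloring_of_outdegree_le {V : Type*} [Fintype V] [DecidableEq V] {k u D N : ℕ}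
    (hk : 2 ≤ k) (hu0 : 0 < u) (hu : SufficientSlack k u) (hN : N = D + k + 3 * u + 1)
    (hNk : N ≤ 27 * (k + u)) (hNu : N ≤ u * u) (In : V → Finset V)
    (hanti : ∀ v w, w ∈ In v → v ∉ In w)
    (hD : ∀ w, (Finset.univ.filter fun v => w ∈ In v).card ≤ D) :
    ∃ col : V → V → (Fin N × Bool) ⊕ Fin (k + 6 * u),
      (∀ v w, w ∈ In v → col v w = col w v) ∧
      (∀ v c, (Finset.univ.filter fun w => (w ∈ In v ∨ v ∈ In w) ∧ col v w = c).card = 0 ∨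
        (Finset.univ.filter fun w => (w ∈ In v ∨ v ∈ In w) ∧ col v w = c).card % k = 1) ∧
      ∀ v, ((Finset.univ.filter fun w => w ∈ In v ∨ v ∈ In w).image (col v)).card ≤
        N + D + u := by
  classical
  have : NeZero N := ⟨by omega⟩
  have : NeZero (k + 6 * u) := ⟨by omega⟩
  obtain ⟨lab, π, hout, hin, hπ, hsp⟩ := exists_class_labelling (K := Fin N) (D := D) hk hu
    (by simpa using hNk) (by simp [hN]) In hD
  have hsp' : ∀ v, ((In v).filter (lab · v = none)).card ≤ u := fun v => by
    refine Nat.le_of_mul_le_mul_right ((hsp v).trans ?_) hu0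
    simpa using hNu
  let S : SimpleGraph V :=
    { Adj := fun v w => (w ∈ In v ∧ lab w v = none) ∨ (v ∈ In w ∧ lab v w = none)
      symm := ⟨fun v w h => h.symm⟩
      loopless := ⟨fun v h => by
        have hv : v ∈ In v := h.elim And.left And.left
        exact hanti v v hv hv⟩ }
  obtain ⟨ord, hord, hback⟩ := exists_degenerate_order_of_indegree_le S u
    (fun v => (In v).filter (lab · v = none)) hsp' (by
      intro v w h
      simpa [S] using h)
  obtain ⟨cs, hcs, -, hcscount⟩ := exists_sequential_coloring (K := Fin (k + 6 * u)) hk hu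
    (by simp; omega) S ord hord (fun _ => ∅) (by
      intro v w _ _
      have h1 := hback v
      have h2 := hback w
      simp only [Finset.card_empty, Fintype.card_fin]
      omega)
  let arc : V → V → (Fin N × Bool) ⊕ Fin (k + 6 * u) := fun w v =>
    (lab w v).elim (Sum.inr (cs v w)) fun j => Sum.inl (j, π j v)
  let col : V → V → (Fin N × Bool) ⊕ Fin (k + 6 * u) := fun v w =>
    if w ∈ In v then arc w v else arc v w
  have hcolin : ∀ {v w}, w ∈ In v → col v w = arc w v := fun h => if_pos h
  have hcolout : ∀ {v w}, v ∈ In w → col v w = arc v w := fun h => if_neg (hanti _ _ h)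
  have harcl : ∀ {w v j b}, arc w v = Sum.inl (j, b) ↔ lab w v = some j ∧ b = π j v := by
    intro w v j b
    cases h : lab w v with
    | none => simp [arc, h]
    | some i =>
      simp only [arc, h, Option.elim_some, Sum.inl.injEq, Prod.mk.injEq, Option.some.injEq]
      constructor
      · rintro ⟨rfl, rfl⟩; exact ⟨rfl, rfl⟩
      · rintro ⟨rfl, rfl⟩; exact ⟨rfl, rfl⟩
  have harcr : ∀ {w v t}, arc w v = Sum.inr t ↔ lab w v = none ∧ cs v w = t := by
    intro w v t
    cases h : lab w v <;> simp [arc, h]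
  refine ⟨col, fun v w h => by rw [hcolin h, hcolout h], ?_, ?_⟩
  · rintro v (⟨j, b⟩ | t)
    · by_cases hb : b = π j v
      · have hset : (Finset.univ.filter fun w => (w ∈ In v ∨ v ∈ In w) ∧
            col v w = Sum.inl (j, b)) = (In v).filter (lab · v = some j) := by
          ext w
          simp only [Finset.mem_filter, Finset.mem_univ, true_and]
          constructor
          · rintro ⟨h | h, hc⟩
            · rw [hcolin h, harcl] at hc
              exact ⟨h, hc.1⟩
            · rw [hcolout h, harcl] at hc
              exact absurd (hb.symm.trans hc.2) (hπ _ _ _ h hc.1)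
          · rintro ⟨h, hl⟩
            exact ⟨Or.inl h, by rw [hcolin h, harcl]; exact ⟨hl, hb⟩⟩
        rw [hset]
        exact hin v j
      · have : (Finset.univ.filter fun w => (w ∈ In v ∨ v ∈ In w) ∧
            col v w = Sum.inl (j, b)).card ≤ 1 := by
          rw [Finset.card_le_one]
          have key : ∀ w, ((w ∈ In v ∨ v ∈ In w) ∧ col v w = Sum.inl (j, b)) →
              v ∈ In w ∧ lab v w = some j := by
            rintro w ⟨h | h, hc⟩
            · rw [hcolin h, harcl] at hc
              exact absurd hc.2 hb
            · rw [hcolout h, harcl] at hc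
              exact ⟨h, hc.1⟩
          intro w hw w' hw'
          have h1 := key w (Finset.mem_filter.1 hw).2
          have h2 := key w' (Finset.mem_filter.1 hw').2
          exact hout _ _ _ _ h1.1 h2.1 h1.2 h2.2
        obtain h | h := Nat.le_one_iff_eq_zero_or_eq_one.1 this
        · exact Or.inl h
        · exact Or.inr (by rw [h]; exact Nat.mod_eq_of_lt hk)
    · have hset : (Finset.univ.filter fun w => (w ∈ In v ∨ v ∈ In w) ∧
          col v w = Sum.inr t) = Finset.univ.filter fun w => S.Adj v w ∧ cs v w = t := by
        ext w
        simp only [Finset.mem_filter, Finset.mem_univ, true_and]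
        constructor
        · rintro ⟨h | h, hc⟩
          · rw [hcolin h, harcr] at hc
            exact ⟨Or.inl ⟨h, hc.1⟩, hc.2⟩
          · rw [hcolout h, harcr] at hc
            have hS : S.Adj v w := Or.inr ⟨h, hc.1⟩
            exact ⟨hS, (hcs v w hS).trans hc.2⟩
        · rintro ⟨hS, hc⟩
          rcases hS with ⟨h, hl⟩ | ⟨h, hl⟩
          · exact ⟨Or.inl h, by rw [hcolin h, harcr]; exact ⟨hl, hc⟩⟩
          · refine ⟨Or.inr h, ?_⟩
            rw [hcolout h, harcr]
            exact ⟨hl, (hcs v w (Or.inr ⟨h, hl⟩)).symm.trans hc⟩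
      rw [hset]
      exact hcscount v t
  · intro v
    have hsub : (Finset.univ.filter fun w => w ∈ In v ∨ v ∈ In w).image (col v) ⊆
        (Finset.univ.image fun j : Fin N => Sum.inl (j, π j v)) ∪
        (((Finset.univ.filter fun w => v ∈ In w).image (col v)) ∪
        (((In v).filter (lab · v = none)).image (col v))) := by
      intro c hc
      obtain ⟨w, hw, rfl⟩ := Finset.mem_image.1 hc
      simp only [Finset.mem_union]
      rcases (Finset.mem_filter.1 hw).2 with h | h
      · cases hl : lab w v with
        | none => exact Or.inr (Or.inr (Finset.mem_image_of_mem _ (by simp [h, hl])))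
        | some j =>
          refine Or.inl (Finset.mem_image.2 ⟨j, Finset.mem_univ _, ?_⟩)
          rw [hcolin h, eq_comm, harcl]
          exact ⟨hl, rfl⟩
      · exact Or.inr (Or.inl (Finset.mem_image_of_mem _ (by simp [h])))
    refine (Finset.card_le_card hsub).trans ((Finset.card_union_le _ _).trans ?_)
    have h1 := Finset.card_union_le ((Finset.univ.filter fun w => v ∈ In w).image (col v))
      (((In v).filter (lab · v = none)).image (col v))
    have h2 : (Finset.univ.image fun j : Fin N =>
        (Sum.inl (j, π j v) : (Fin N × Bool) ⊕ Fin (k + 6 * u))).card ≤ N :=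
      Finset.card_image_le.trans (by simp)
    have h3 := (Finset.card_image_le (s := Finset.univ.filter fun w => v ∈ In w)
      (f := col v)).trans (hD v)
    have h4 := (Finset.card_image_le (s := (In v).filter (lab · v = none))
      (f := col v)).trans (hsp' v)
    omega

open Classical in
/-- Every graph has a colouring of its edges with `4 p + 3 k + 12 u` colours such that the degrees
in each colour class are zero or congruent to `1` modulo `k`, where `p` is a prime with
`k ≤ p ≤ 6 k` and `u` is large enough. -/
theorem SimpleGraph.exists_mod_coloring {V : Type*} [Fintype V] {k p u : ℕ} (hk : 2 ≤ k)
    (hp : p.Prime) (hkp : k ≤ p) (hpk : p ≤ 6 * k) (hu0 : 0 < u) (hu : SufficientSlack k u)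
    (hpu : 2 * p + k + 3 * u ≤ u * u) (G : SimpleGraph V) :
    ∃ (K : Type) (_ : Fintype K) (col : V → V → K), Fintype.card K ≤ 4 * p + 3 * k + 12 * u ∧
      (∀ v w, G.Adj v w → col v w = col w v) ∧
      ∀ v c, {w | G.Adj v w ∧ col v w = c}.ncard = 0 ∨
        {w | G.Adj v w ∧ col v w = c}.ncard % k = 1 := by
  obtain ⟨H, W, In, hHG, hH, hHW, hWW, hWk, hIn, hIn', hD⟩ :=
    SimpleGraph.exists_degreesModEqOne_structure hk hp hkp G
  have hp2 := hp.two_le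
  set N := 2 * (p - 1) + k + 3 * u + 1 with hN
  obtain ⟨c₁, hc₁, hcount₁, hused⟩ := exists_coloring_of_outdegree_le hk hu0 hu hN (by omega)
    (by omega) In (fun v w h => (hIn' v w h).2.2.2.2) (by convert hD)
  let B : V → Finset ((Fin N × Bool) ⊕ Fin (k + 6 * u)) := fun v =>
    (Finset.univ.filter fun w => w ∈ In v ∨ v ∈ In w).image (c₁ v)
  have hBW : ∀ v, W v → B v = ∅ := fun v hv => by
    rw [Finset.image_eq_empty, Finset.filter_eq_empty_iff]
    rintro w - (h | h)
    · exact (hIn' _ _ h).2.2.1 hv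
    · exact (hIn' _ _ h).2.2.2.1 hv
  let M : SimpleGraph V :=
    { Adj := fun v w => G.Adj v w ∧ (W v ∨ W w)
      symm := ⟨fun v w h => ⟨h.1.symm, h.2.symm⟩⟩
      loopless := ⟨fun v h => h.1.ne rfl⟩ }
  let e := Fintype.equivFin V
  let ord : V → ℕ := fun v => if W v then e v else Fintype.card V + e v
  have hordW : ∀ v, W v → ord v < Fintype.card V := fun v hv => by simp [ord, hv]
  have hordW' : ∀ v, ¬W v → Fintype.card V ≤ ord v := fun v hv => by simp [ord, hv]
  have hord : Function.Injective ord := by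
    intro v w h
    have hv := (e v).isLt
    have hw := (e w).isLt
    refine e.injective (Fin.ext ?_)
    simp only [ord] at h
    split_ifs at h <;> omega
  have hback : ∀ v, W v → (Finset.univ.filter fun x => M.Adj v x ∧ ord x < ord v) = ∅ := by
    intro v hv
    rw [Finset.filter_eq_empty_iff]
    rintro x - ⟨hx, hlt⟩
    have hxW : ¬W x := fun hxW => hWW v x hv hxW hx.1
    have h1 := hordW v hv
    have h2 := hordW' x hxW
    omega
  have hback' : ∀ v, ¬W v → (Finset.univ.filter fun x => M.Adj v x ∧ ord x < ord v).card < k := by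
    intro v hv
    refine lt_of_le_of_lt ?_ (hWk v hv)
    rw [Set.ncard_eq_toFinset_card']
    refine Finset.card_le_card fun x hx => ?_
    have hx := (Finset.mem_filter.1 hx).2.1
    exact Set.mem_toFinset.2 ⟨hx.1, hx.2.resolve_left hv⟩
  have : NeZero (k + 6 * u) := ⟨by omega⟩
  obtain ⟨c₂, hc₂, hB, hcount₂⟩ :=
    exists_sequential_coloring hk hu (by simp; omega) M ord hord B (by
    intro v w hvw hlt
    have hv : W v := by
      rcases hvw.2 with h | h
      · exact h
      · by_contra hv
        have h1 := hordW w h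
        have h2 := hordW' v hv
        omega
    have hw : ¬W w := fun hw => hWW v w hv hw hvw.1
    have h1 := hback' w hw
    have h2 : (B w).card ≤ _ := hused w
    rw [hBW v hv, hback v hv]
    simp only [Finset.card_empty, Fintype.card_sum, Fintype.card_prod, Fintype.card_fin,
      Fintype.card_bool]
    omega)
  refine ⟨Option ((Fin N × Bool) ⊕ Fin (k + 6 * u)), inferInstance, fun v w =>
    if H.Adj v w then none else if W v ∨ W w then some (c₂ v w) else some (c₁ v w), ?_, ?_, ?_⟩
  · simp only [Fintype.card_option, Fintype.card_sum, Fintype.card_prod, Fintype.card_fin,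
      Fintype.card_bool]
    omega
  · intro v w hvw
    simp only [H.adj_comm v w, or_comm (a := W v)]
    split_ifs with h1 h2
    · rfl
    · rw [hc₂ v w ⟨hvw, h2.symm⟩]
    · rw [not_or] at h2
      rcases hIn v w h2.2 h2.1 hvw (fun h => h1 h.symm) with h | h
      · rw [hc₁ v w h]
      · rw [hc₁ w v h]
  · rintro v (_ | c)
    · have hset : {w | G.Adj v w ∧ (if H.Adj v w then none else
          if W v ∨ W w then some (c₂ v w) else some (c₁ v w)) = none} = {w | H.Adj v w} := by
        ext w
        simp only [Set.mem_ofPred_eq]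
        constructor
        · rintro ⟨-, h⟩
          by_contra h'
          rw [if_neg h'] at h
          split_ifs at h
        · exact fun h => ⟨hHG h, if_pos h⟩
      rw [hset]
      exact hH v
    · have hset : {w | G.Adj v w ∧ (if H.Adj v w then none else
          if W v ∨ W w then some (c₂ v w) else some (c₁ v w)) = some c} =
          ↑((Finset.univ.filter fun w => M.Adj v w ∧ c₂ v w = c) ∪
            Finset.univ.filter fun w => (w ∈ In v ∨ v ∈ In w) ∧ c₁ v w = c) := by
        ext w
        simp only [Set.mem_ofPred_eq, Finset.coe_union, Finset.coe_filter, Finset.mem_univ,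
          true_and, Set.mem_union]
        constructor
        · rintro ⟨hG, h⟩
          split_ifs at h with h1 h2
          · exact Or.inl ⟨⟨hG, h2⟩, Option.some.inj h⟩
          · rw [not_or] at h2
            exact Or.inr ⟨hIn v w h2.1 h2.2 hG h1, Option.some.inj h⟩
        · rintro (⟨h, hc⟩ | ⟨h | h, hc⟩)
          · refine ⟨h.1, ?_⟩
            rw [if_neg, if_pos h.2, hc]
            intro hvw
            exact h.2.elim (hHW v w hvw) (hHW w v hvw.symm)
          · obtain ⟨h1, h2, h3, h4, -⟩ := hIn' v w h
            refine ⟨h1, ?_⟩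
            rw [if_neg h2, if_neg (not_or.2 ⟨h3, h4⟩), hc]
          · obtain ⟨h1, h2, h3, h4, -⟩ := hIn' w v h
            refine ⟨h1.symm, ?_⟩
            rw [if_neg (fun h => h2 h.symm), if_neg (not_or.2 ⟨h4, h3⟩), hc]
      rw [hset, Set.ncard_coe_finset]
      by_cases hne : (Finset.univ.filter fun w => (w ∈ In v ∨ v ∈ In w) ∧ c₁ v w = c) = ∅
      · rw [hne, Finset.union_empty]
        exact hcount₂ v c
      · obtain ⟨w, hw⟩ := Finset.nonempty_iff_ne_empty.2 hne
        have hw := (Finset.mem_filter.1 hw).2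
        have hcB : c ∈ B v := Finset.mem_image.2 ⟨w, by simpa using hw.1, hw.2⟩
        have : (Finset.univ.filter fun w => M.Adj v w ∧ c₂ v w = c) = ∅ :=
          Finset.filter_eq_empty_iff.2 fun x _ hx => hB v x hx.1 (hx.2.symm ▸ hcB)
        rw [this, Finset.empty_union]
        exact hcount₁ v c

theorem modChromaticIndex_le {V : Type*} [Fintype V] {k p u : ℕ} (hk : 2 ≤ k) (hp : p.Prime)
    (hkp : k ≤ p) (hpk : p ≤ 6 * k) (hu0 : 0 < u) (hu : SufficientSlack k u)
    (hpu : 2 * p + k + 3 * u ≤ u * u) (G : SimpleGraph V) :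
    modChromaticIndex k G ≤ 4 * p + 3 * k + 12 * u := by
  obtain ⟨K, _, col, hK, hsymm, hcol⟩ := G.exists_mod_coloring hk hp hkp hpk hu0 hu hpu
  refine le_trans (Nat.sInf_le (m := Fintype.card K) ?_) hK
  let c : G.edgeSet → Fin (Fintype.card K) := fun e =>
    Fintype.equivFin K (col (Quot.out e.1).1 (Quot.out e.1).2)
  have hc : ∀ v w (h : G.Adj v w), c ⟨s(v, w), h⟩ = Fintype.equivFin K (col v w) := by
    intro v w h
    simp only [c, EmbeddingLike.apply_eq_iff_eq]
    have hout : s((Quot.out s(v, w)).1, (Quot.out s(v, w)).2) = s(v, w) := Quot.out_eq _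
    rcases Sym2.eq_iff.1 hout with ⟨h1, h2⟩ | ⟨h1, h2⟩
    · rw [h1, h2]
    · rw [h1, h2, hsymm v w h]
  refine ⟨c, fun i v h0 => ?_⟩
  have hdeg : colorClassDegree G c i v =
      {w | G.Adj v w ∧ col v w = (Fintype.equivFin K).symm i}.ncard := by
    unfold colorClassDegree
    congr 1
    ext w
    simp only [Set.mem_ofPred_eq]
    constructor
    · rintro ⟨h, hi⟩
      rw [hc] at hi
      exact ⟨h, by rw [← hi, Equiv.symm_apply_apply]⟩
    · rintro ⟨h, hi⟩
      exact ⟨h, by rw [hc, hi, Equiv.apply_symm_apply]⟩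
  rw [hdeg] at h0 ⊢
  exact (hcol v _).resolve_left h0
section PrimeGaps

open Filter Topology Chebyshev
open ArithmeticFunction hiding log

theorem exists_continuousOn_eq_LSeries_vonMangoldt_sub_one :
    ∃ Φ : ℂ → ℂ, ContinuousOn Φ {s | 1 ≤ s.re} ∧
      ∀ s : ℂ, 1 < s.re → LSeriesHasSum (fun n => ((vonMangoldt n - 1 : ℝ) : ℂ)) s (Φ s) := by
  let ζ₁ : ℂ → ℂ := Function.update (fun s => riemannZeta s - 1 / (s - 1)) 1
    Real.eulerMascheroniConstant
  have hζ₁ : Continuous ζ₁ := by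
    rw [continuous_iff_continuousAt]
    intro s
    rcases eq_or_ne s 1 with rfl | hs
    · exact continuousAt_update_same.2 tendsto_riemannZeta_sub_one_div
    · refine (continuousAt_update_of_ne hs).2 (ContinuousAt.sub ?_ ?_)
      · exact (differentiableAt_riemannZeta hs).continuousAt
      · exact continuousAt_const.div (by fun_prop) (sub_ne_zero.2 hs)
  refine ⟨fun s => vonMangoldt.LFunctionResidueClassAux (1 : ZMod 1) s - ζ₁ s,
    (vonMangoldt.continuousOn_LFunctionResidueClassAux _).sub hζ₁.continuousOn, fun s hs => ?_⟩
  have hs1 : s ≠ 1 := by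
    rintro rfl
    simp at hs
  have hres : ∀ n, vonMangoldt.residueClass (1 : ZMod 1) n = vonMangoldt n := fun n =>
    Set.indicator_of_mem (s := {n : ℕ | (n : ZMod 1) = 1}) (Subsingleton.elim _ _) _
  have h1 := vonMangoldt.eqOn_LFunctionResidueClassAux (q := 1) (a := 1) isUnit_one hs
  have h2 : LSeriesHasSum (fun n => (vonMangoldt n : ℂ)) s
      (LSeries (fun n => (vonMangoldt n : ℂ)) s) :=
    (LSeriesSummable_vonMangoldt hs).LSeriesHasSum
  have h3 := h2.sub (LSeriesHasSum_one hs)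
  convert! h3 using 1
  · ext n
    simp
  · simp only [h1, hres, ζ₁, Function.update_of_ne hs1, Nat.totient_one]
    simp

/-- The half Fejér kernel `∫₀^L (1 - t / L) cos (t u) dt`. -/
noncomputable def fejer (L u : ℝ) : ℝ := ∫ t in (0 : ℝ)..L, (1 - t / L) * Real.cos (t * u)

theorem fejer_eq {L u : ℝ} (hL : L ≠ 0) (hu : u ≠ 0) :
    fejer L u = (1 - Real.cos (L * u)) / (L * u ^ 2) := by
  have hderiv : ∀ t ∈ Set.uIcc 0 L, HasDerivAt (fun t => (1 - t / L) * (Real.sin (t * u) / u) -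
      Real.cos (t * u) / (L * u ^ 2)) ((1 - t / L) * Real.cos (t * u)) t := by
    intro t _
    have h1 : HasDerivAt (fun t => 1 - t / L) (-(1 / L)) t :=
      ((hasDerivAt_id t).div_const L).const_sub 1
    have h2 : HasDerivAt (fun t => t * u) u t := by simpa using (hasDerivAt_id t).mul_const u
    have h3 := (h1.mul (h2.sin.div_const u)).sub (h2.cos.div_const (L * u ^ 2))
    convert! h3 using 1
    field_simp
    ring
  rw [fejer, intervalIntegral.integral_eq_sub_of_hasDerivAt hderiv
    (Continuous.intervalIntegrable (by fun_prop) _ _)]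
  field_simp
  simp
  ring

theorem fejer_zero {L : ℝ} (hL : L ≠ 0) : fejer L 0 = L / 2 := by
  simp only [fejer, mul_zero, Real.cos_zero, mul_one]
  rw [intervalIntegral.integral_sub (by simp) (Continuous.intervalIntegrable (by fun_prop) _ _)]
  simp only [intervalIntegral.integral_div, integral_id, intervalIntegral.integral_const,
    smul_eq_mul]
  field_simp
  ring

theorem fejer_nonneg {L : ℝ} (hL : 0 < L) (u : ℝ) : 0 ≤ fejer L u := by
  rcases eq_or_ne u 0 with rfl | hu
  · rw [fejer_zero hL.ne']
    positivity
  · rw [fejer_eq hL.ne' hu]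
    have := Real.cos_le_one (L * u)
    exact div_nonneg (by linarith) (by positivity)

theorem fejer_le {L : ℝ} (hL : 0 < L) (u : ℝ) : fejer L u ≤ L := by
  rcases eq_or_ne u 0 with rfl | hu
  · rw [fejer_zero hL.ne']
    linarith
  · rw [fejer_eq hL.ne' hu, div_le_iff₀ (by positivity)]
    have := Real.one_sub_sq_div_two_le_cos (x := L * u)
    nlinarith [mul_pos hL hL, sq_nonneg (L * u)]

theorem fejer_le_div_sq {L u : ℝ} (hL : 0 < L) (hu : u ≠ 0) : fejer L u ≤ 2 / (L * u ^ 2) := by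
  rw [fejer_eq hL.ne' hu]
  have := Real.neg_one_le_cos (L * u)
  gcongr
  linarith

theorem le_fejer {L u : ℝ} (hL : 0 < L) (hu : |u| ≤ 1 / L) : L / 4 ≤ fejer L u := by
  have h1 : ∫ t in (0 : ℝ)..L, (1 - t / L) * (1 / 2) = L / 4 := by
    have := fejer_zero hL.ne'
    simp only [fejer, mul_zero, Real.cos_zero, mul_one] at this
    rw [intervalIntegral.integral_mul_const, this]
    ring
  rw [← h1, fejer]
  refine intervalIntegral.integral_mono_on hL.le (Continuous.intervalIntegrable (by fun_prop) _ _)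
    (Continuous.intervalIntegrable (by fun_prop) _ _) fun t ht => ?_
  have h2 : t / L ≤ 1 := (div_le_one hL).2 ht.2
  refine mul_le_mul_of_nonneg_left ?_ (by linarith)
  have h3 := Real.one_sub_sq_div_two_le_cos (x := t * u)
  have h4 : |t * u| ≤ 1 := by
    rw [abs_mul, abs_of_nonneg ht.1]
    calc t * |u| ≤ L * (1 / L) := by gcongr; exact ht.2
      _ = 1 := by field_simp
  have h5 : (t * u) ^ 2 ≤ 1 := by
    rw [← sq_abs]
    exact pow_le_one₀ (abs_nonneg _) h4
  linarith

theorem hasSum_mul_fejer {a : ℕ → ℝ} {Φ : ℂ → ℂ} {σ : ℝ} (hσ : 1 < σ)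
    (ha : ∀ t : ℝ, LSeriesHasSum (fun n => (a n : ℂ)) (σ - t * Complex.I) (Φ (σ - t * Complex.I)))
    {L : ℝ} (hL : 0 < L) (y : ℝ) :
    HasSum (fun n : ℕ => a n * (n : ℝ) ^ (-σ) * fejer L (Real.log n - y))
      (∫ t in (0 : ℝ)..L, ((1 - t / L : ℝ) : ℂ) *
        (Complex.exp (-(t * y) * Complex.I) * Φ (σ - t * Complex.I))).re := by
  let F : ℕ → ℝ → ℂ := fun n t => ((a n * (n : ℝ) ^ (-σ) : ℝ) : ℂ) *
    (((1 - t / L : ℝ) : ℂ) * Complex.exp ((t * (Real.log n - y) : ℝ) * Complex.I))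
  have hterm : ∀ (n : ℕ) (t : ℝ), F n t = ((1 - t / L : ℝ) : ℂ) *
      (Complex.exp (-(t * y) * Complex.I) *
        LSeries.term (fun n => (a n : ℂ)) (σ - t * Complex.I) n) := by
    intro n t
    rcases eq_or_ne n 0 with rfl | hn
    · have : (0 : ℝ) ^ (-σ) = 0 := Real.zero_rpow (by linarith)
      simp [F, this]
    · have hn0 : (n : ℂ) ≠ 0 := Nat.cast_ne_zero.2 hn
      rw [LSeries.term_of_ne_zero hn, div_eq_mul_inv (a n : ℂ), ← Complex.cpow_neg,
        Complex.cpow_def_of_ne_zero hn0]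
      simp only [F]
      rw [Real.rpow_def_of_pos (by positivity)]
      push_cast
      have : Complex.exp ((t * (Complex.log n - y)) * Complex.I) *
          Complex.exp (Complex.log n * -σ) =
          Complex.exp (-(t * y) * Complex.I) *
            Complex.exp (Complex.log n * -(σ - t * Complex.I)) := by
        rw [← Complex.exp_add, ← Complex.exp_add]
        congr 1
        ring
      linear_combination ((a n : ℂ) * (1 - t / L)) * this
  have hnorm : ∀ n t, t ∈ Set.uIoc 0 L → ‖F n t‖ ≤ |a n| * (n : ℝ) ^ (-σ) := by
    intro n t ht
    rw [Set.uIoc_of_le hL.le] at ht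
    have h1 : t / L ≤ 1 := (div_le_one hL).2 ht.2
    have h2 : 0 < t / L := div_pos ht.1 hL
    rw [norm_mul, norm_mul, Complex.norm_exp_ofReal_mul_I, Complex.norm_real, Complex.norm_real,
      Real.norm_eq_abs, Real.norm_eq_abs, abs_mul,
      abs_of_nonneg (a := (n : ℝ) ^ (-σ)) (by positivity),
      abs_of_nonneg (a := 1 - t / L) (by linarith)]
    have h3 : 0 ≤ |a n| * (n : ℝ) ^ (-σ) := by positivity
    nlinarith
  have hsummable : Summable fun n : ℕ => |a n| * (n : ℝ) ^ (-σ) := by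
    have h := (ha 0).LSeriesSummable.norm
    refine h.congr fun n => ?_
    rw [LSeries.norm_term_eq]
    split_ifs with hn
    · have : (0 : ℝ) ^ (-σ) = 0 := Real.zero_rpow (by linarith)
      simp [hn, this]
    · simp [Real.rpow_neg, div_eq_mul_inv]
  have hsum := intervalIntegral.hasSum_integral_of_dominated_convergence (μ := MeasureTheory.volume)
    (F := F) (a := 0) (b := L)
    (f := fun t => ((1 - t / L : ℝ) : ℂ) *
      (Complex.exp (-(t * y) * Complex.I) * Φ (σ - t * Complex.I)))
    (fun n _ => |a n| * (n : ℝ) ^ (-σ))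
    (fun n => Continuous.aestronglyMeasurable (by fun_prop))
    (fun n => Eventually.of_forall fun t ht => hnorm n t ht)
    (Eventually.of_forall fun t _ => hsummable) (by simp)
    (Eventually.of_forall fun t _ => by
      simp only [hterm]
      exact ((ha t).mul_left _).mul_left _)
  refine (Complex.hasSum_re hsum).congr_fun fun n => ?_
  rw [← Complex.reCLM_apply, ← Complex.reCLM.intervalIntegral_comp_comm
    (Continuous.intervalIntegrable (by fun_prop) _ _), fejer,
    ← intervalIntegral.integral_const_mul]
  refine intervalIntegral.integral_congr fun t _ => ?_
  simp only [F, Complex.reCLM_apply]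
  rw [Complex.re_ofReal_mul, Complex.re_ofReal_mul, Complex.exp_ofReal_mul_I_re]

theorem tendsto_integral_nhdsGT_one {Φ : ℂ → ℂ} (hΦ : ContinuousOn Φ {s | 1 ≤ s.re}) (L y : ℝ) :
    Tendsto (fun σ : ℝ => ∫ t in (0 : ℝ)..L, ((1 - t / L : ℝ) : ℂ) *
        (Complex.exp (-(t * y) * Complex.I) * Φ (σ - t * Complex.I))) (𝓝[>] 1)
      (𝓝 (∫ t in (0 : ℝ)..L, ((1 - t / L : ℝ) : ℂ) *
        (Complex.exp (-(t * y) * Complex.I) * Φ (1 - t * Complex.I)))) := by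
  have hΨ : Continuous fun p : ℝ × ℝ => Φ ((max p.1 1 : ℝ) - p.2 * Complex.I) :=
    hΦ.comp_continuous (by fun_prop) fun p => by simp
  have hc : Continuous fun σ : ℝ => ∫ t in (0 : ℝ)..L, ((1 - t / L : ℝ) : ℂ) *
      (Complex.exp (-(t * y) * Complex.I) * Φ ((max σ 1 : ℝ) - t * Complex.I)) :=
    intervalIntegral.continuous_parametric_intervalIntegral_of_continuous'
      (f := fun (σ t : ℝ) => ((1 - t / L : ℝ) : ℂ) *
        (Complex.exp (-(t * y) * Complex.I) * Φ ((max σ 1 : ℝ) - t * Complex.I)))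
      (by
        simp only [Function.uncurry_def]
        exact Continuous.mul (by fun_prop) (Continuous.mul (by fun_prop) hΨ)) 0 L
  have h := (hc.tendsto 1).mono_left (nhdsWithin_le_nhds (s := Set.Ioi 1))
  simp only [max_self, Complex.ofReal_one] at h
  refine h.congr' ?_
  filter_upwards [self_mem_nhdsWithin] with σ hσ
  rw [max_eq_left (le_of_lt hσ)]

theorem tendsto_integral_exp_atTop {Ψ : ℝ → ℂ} {L : ℝ} (hL : 0 < L) :
    Tendsto (fun y : ℝ => ∫ t in (0 : ℝ)..L, ((1 - t / L : ℝ) : ℂ) *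
        (Complex.exp (-(t * y) * Complex.I) * Ψ t)) atTop (𝓝 0) := by
  have h := (Real.tendsto_integral_exp_smul_cocompact
    ((Set.Ioc 0 L).indicator fun t : ℝ => ((1 - t / L : ℝ) : ℂ) * Ψ t)).comp
    ((tendsto_id.atTop_div_const Real.two_pi_pos).mono_right atTop_le_cocompact)
  refine h.congr fun y => ?_
  rw [intervalIntegral.integral_of_le hL.le,
    ← MeasureTheory.integral_indicator measurableSet_Ioc]
  refine MeasureTheory.integral_congr_ae (Eventually.of_forall fun t => ?_)
  by_cases ht : t ∈ Set.Ioc 0 L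
  · simp only [Set.indicator_of_mem ht, Circle.smul_def, Real.fourierChar_apply, smul_eq_mul, id]
    have : ((2 * Real.pi * -(t * (y / (2 * Real.pi))) : ℝ) : ℂ) = -(t * y) := by
      have : 2 * Real.pi * -(t * (y / (2 * Real.pi))) = -(t * y) := by
        field_simp
      rw [this]
      push_cast
      rfl
    rw [this]
    ring
  · simp [Set.indicator_of_notMem ht]

theorem sum_le_sum_of_le_ite {ι : Type*} [DecidableEq ι] {s t : Finset ι} {f g : ι → ℝ}
    (hg : ∀ i ∈ t, 0 ≤ g i) (h : ∀ i ∈ s, f i ≤ if i ∈ t then g i else 0) :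
    ∑ i ∈ s, f i ≤ ∑ i ∈ t, g i := by
  refine (Finset.sum_le_sum h).trans ?_
  rw [Finset.sum_ite_mem]
  exact Finset.sum_le_sum_of_subset_of_nonneg Finset.inter_subset_right fun i hi _ => hg i hi

theorem exists_sum_vonMangoldt_div_le :
    ∃ C : ℝ, ∀ (y : ℝ) (s : Finset ℕ),
      ∑ n ∈ s, vonMangoldt n / n / (1 + (Real.log n - y) ^ 2) ≤ C := by
  have hsum : Summable fun j : ℤ => 1 / (1 + (j : ℝ) ^ 2) := by
    refine Summable.of_norm_bounded_eventually
      (Real.summable_one_div_int_pow.2 one_lt_two) ?_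
    filter_upwards [(Set.finite_singleton (0 : ℤ)).compl_mem_cofinite] with j hj
    have hj0 : (j : ℝ) ≠ 0 := by exact_mod_cast hj
    rw [Real.norm_of_nonneg (by positivity)]
    exact one_div_le_one_div_of_le (by positivity) (by linarith)
  let M : ℝ := 3 * ((Real.log 4 + 4) * Real.exp 1)
  refine ⟨M * ∑' j : ℤ, 1 / (1 + (j : ℝ) ^ 2), fun y s => ?_⟩
  rw [← Finset.sum_fiberwise_of_maps_to (g := fun n : ℕ => ⌊Real.log n - y⌋)
    (t := s.image fun n : ℕ => ⌊Real.log n - y⌋) (fun n hn => Finset.mem_image_of_mem _ hn)]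
  calc _ ≤ ∑ j ∈ s.image (fun n : ℕ => ⌊Real.log n - y⌋), M * (1 / (1 + (j : ℝ) ^ 2)) := by
        refine Finset.sum_le_sum fun j _ => ?_
        calc _ ≤ ∑ n ∈ Finset.Ioc 0 ⌊Real.exp (y + j + 1)⌋₊,
              3 * Real.exp (-(y + j)) * (1 / (1 + (j : ℝ) ^ 2)) * vonMangoldt n := by
              refine sum_le_sum_of_le_ite (fun n _ => by positivity) fun n hn => ?_
              rcases Nat.eq_zero_or_pos n with rfl | hn0
              · simp
              have hn0' : (0 : ℝ) < n := Nat.cast_pos.2 hn0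
              have hj := (Finset.mem_filter.1 hn).2
              have h1 := Int.floor_le (Real.log n - y)
              have h2 := Int.lt_floor_add_one (Real.log n - y)
              rw [hj] at h1 h2
              have hle : (n : ℝ) ≤ Real.exp (y + j + 1) :=
                (Real.log_le_iff_le_exp hn0').1 (by linarith)
              have hge : Real.exp (y + j) ≤ n := (Real.le_log_iff_exp_le hn0').1 (by linarith)
              rw [if_pos (Finset.mem_Ioc.2 ⟨hn0, Nat.le_floor hle⟩)]
              have h3 : 1 / (1 + (Real.log n - y) ^ 2) ≤ 3 * (1 / (1 + (j : ℝ) ^ 2)) := by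
                rw [mul_one_div, div_le_div_iff₀ (by positivity) (by positivity)]
                nlinarith [sq_nonneg (2 * (Real.log n - y) - j)]
              have h4 : (n : ℝ)⁻¹ ≤ Real.exp (-(y + j)) := by
                rw [Real.exp_neg]
                exact inv_anti₀ (Real.exp_pos _) hge
              calc vonMangoldt n / n / (1 + (Real.log n - y) ^ 2)
                  = vonMangoldt n * ((n : ℝ)⁻¹ * (1 / (1 + (Real.log n - y) ^ 2))) := by ring
                _ ≤ vonMangoldt n * (Real.exp (-(y + j)) * (3 * (1 / (1 + (j : ℝ) ^ 2)))) := by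
                    gcongr
                _ = _ := by ring
          _ = 3 * Real.exp (-(y + j)) * (1 / (1 + (j : ℝ) ^ 2)) * ψ (Real.exp (y + j + 1)) := by
              rw [← Finset.mul_sum, psi]
          _ ≤ 3 * Real.exp (-(y + j)) * (1 / (1 + (j : ℝ) ^ 2)) *
              ((Real.log 4 + 4) * Real.exp (y + j + 1)) := by
              gcongr
              exact psi_le_const_mul_self (Real.exp_pos _).le
          _ = M * (1 / (1 + (j : ℝ) ^ 2)) := by
              have : Real.exp (-(y + j)) * Real.exp (y + j + 1) = Real.exp 1 := by
                rw [← Real.exp_add]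
                congr 1
                ring
              simp only [M, ← this]
              ring
    _ ≤ _ := by
        rw [← Finset.mul_sum]
        exact mul_le_mul_of_nonneg_left (hsum.sum_le_tsum _ fun j _ => by positivity)
          (by positivity)

theorem sum_vonMangoldt_mul_fejer_le {ε L y σ C : ℝ} (hε : 0 < ε) (hL : 0 < L) (hσ : 1 < σ)
    (hC : ∀ s : Finset ℕ, ∑ n ∈ s, vonMangoldt n / n / (1 + (Real.log n - y) ^ 2) ≤ C)
    (hp : ∀ p : ℕ, p.Prime → ε ≤ |Real.log p - y|) (s : Finset ℕ) :
    ∑ n ∈ s, vonMangoldt n * (n : ℝ) ^ (-σ) * fejer L (Real.log n - y) ≤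
      2 / L * (1 + 1 / ε ^ 2) * C +
        L * Real.exp (ε - y) * (ψ (Real.exp (y + ε)) - θ (Real.exp (y + ε))) := by
  let t := {n ∈ Finset.Ioc 0 ⌊Real.exp (y + ε)⌋₊ | ¬ n.Prime}
  have hΛ : ∀ n, 0 ≤ vonMangoldt n := fun n => vonMangoldt_nonneg
  have hmain : ∀ n, vonMangoldt n * (n : ℝ) ^ (-σ) * fejer L (Real.log n - y) ≤
      2 / L * (1 + 1 / ε ^ 2) * (vonMangoldt n / n / (1 + (Real.log n - y) ^ 2)) +
        if n ∈ t then L * Real.exp (ε - y) * vonMangoldt n else 0 := by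
    intro n
    have hA : 0 ≤ 2 / L * (1 + 1 / ε ^ 2) * (vonMangoldt n / n / (1 + (Real.log n - y) ^ 2)) :=
      mul_nonneg (by positivity) (div_nonneg (div_nonneg (hΛ n) (by positivity)) (by positivity))
    have hB : 0 ≤ if n ∈ t then L * Real.exp (ε - y) * vonMangoldt n else 0 := by
      split_ifs
      · exact mul_nonneg (by positivity) (hΛ n)
      · rfl
    rcases Nat.eq_zero_or_pos n with rfl | hn0
    · simp [t]
    have hn1 : (1 : ℝ) ≤ n := by exact_mod_cast hn0
    have hpow : (n : ℝ) ^ (-σ) ≤ (n : ℝ)⁻¹ := by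
      rw [← Real.rpow_neg_one]
      exact Real.rpow_le_rpow_of_exponent_le hn1 (by linarith)
    have hfn := fejer_nonneg hL (Real.log n - y)
    have hstep : vonMangoldt n * (n : ℝ) ^ (-σ) * fejer L (Real.log n - y) ≤
        vonMangoldt n * (n : ℝ)⁻¹ * fejer L (Real.log n - y) :=
      mul_le_mul_of_nonneg_right (mul_le_mul_of_nonneg_left hpow (hΛ n)) hfn
    refine hstep.trans ?_
    rcases le_or_gt ε |Real.log n - y| with hu | hu
    · refine le_add_of_le_of_nonneg ?_ hB
      have hu2 : ε ^ 2 ≤ (Real.log n - y) ^ 2 := by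
        rw [← sq_abs (Real.log n - y)]
        exact pow_le_pow_left₀ hε.le hu 2
      have hu0 : Real.log n - y ≠ 0 := by
        intro h
        rw [h, abs_zero] at hu
        linarith
      have hu3 : 0 < (Real.log n - y) ^ 2 := by positivity
      have h1 : 2 / (L * (Real.log n - y) ^ 2) ≤
          2 / L * (1 + 1 / ε ^ 2) * (1 / (1 + (Real.log n - y) ^ 2)) := by
        have : 1 / (Real.log n - y) ^ 2 ≤ (1 + 1 / ε ^ 2) * (1 / (1 + (Real.log n - y) ^ 2)) := by
          rw [mul_one_div, div_le_div_iff₀ hu3 (by positivity)]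
          have : 1 ≤ 1 / ε ^ 2 * (Real.log n - y) ^ 2 := by
            rw [one_div_mul_eq_div, one_le_div (by positivity)]
            exact hu2
          linarith
        calc _ = 2 / L * (1 / (Real.log n - y) ^ 2) := by field_simp
          _ ≤ 2 / L * ((1 + 1 / ε ^ 2) * (1 / (1 + (Real.log n - y) ^ 2))) := by gcongr
          _ = _ := by ring
      calc _ ≤ vonMangoldt n * (n : ℝ)⁻¹ *
            (2 / L * (1 + 1 / ε ^ 2) * (1 / (1 + (Real.log n - y) ^ 2))) :=
            mul_le_mul_of_nonneg_left ((fejer_le_div_sq hL hu0).trans h1)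
              (mul_nonneg (hΛ n) (by positivity))
        _ = _ := by ring
    · refine le_add_of_nonneg_of_le hA ?_
      have hnp : ¬ n.Prime := fun h => absurd (hp n h) (not_le.2 hu)
      rw [abs_lt] at hu
      have hn0' : (0 : ℝ) < n := by linarith
      have hle : (n : ℝ) ≤ Real.exp (y + ε) := (Real.log_le_iff_le_exp hn0').1 (by linarith)
      have hge : Real.exp (y - ε) ≤ n := (Real.le_log_iff_exp_le hn0').1 (by linarith)
      rw [if_pos (Finset.mem_filter.2 ⟨Finset.mem_Ioc.2 ⟨hn0, Nat.le_floor hle⟩, hnp⟩)]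
      have h4 : (n : ℝ)⁻¹ ≤ Real.exp (ε - y) := by
        rw [← neg_sub, Real.exp_neg]
        exact inv_anti₀ (Real.exp_pos _) hge
      calc _ ≤ vonMangoldt n * Real.exp (ε - y) * L :=
            mul_le_mul (mul_le_mul_of_nonneg_left h4 (hΛ n)) (fejer_le hL _) hfn
              (mul_nonneg (hΛ n) (by positivity))
        _ = _ := by ring
  refine (Finset.sum_le_sum fun n _ => hmain n).trans ?_
  rw [Finset.sum_add_distrib, psi_sub_theta_eq_sum_not_prime, Finset.mul_sum]
  refine add_le_add ((Finset.mul_sum _ _ _).symm.trans_le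
    (mul_le_mul_of_nonneg_left (hC s) (by positivity))) ?_
  rw [Finset.sum_ite_mem]
  exact Finset.sum_le_sum_of_subset_of_nonneg Finset.inter_subset_right
    fun n _ _ => mul_nonneg (by positivity) (hΛ n)

theorem summable_rpow_mul_fejer {L σ : ℝ} (hL : 0 < L) (hσ : 1 < σ) (y : ℝ) :
    Summable fun n : ℕ => (n : ℝ) ^ (-σ) * fejer L (Real.log n - y) :=
  ((Real.summable_nat_rpow.2 (by linarith)).mul_right L).of_nonneg_of_le
    (fun n => mul_nonneg (by positivity) (fejer_nonneg hL _))
    fun n => mul_le_mul_of_nonneg_left (fejer_le hL _) (by positivity)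

theorem le_tsum_rpow_mul_fejer {L σ : ℝ} (hL : 0 < L) (hσ : 1 < σ) (y : ℝ) :
    L / 4 * (Real.exp (-σ * (y + 1 / L)) * (Real.exp y / L - 1)) ≤
      ∑' n : ℕ, (n : ℝ) ^ (-σ) * fejer L (Real.log n - y) := by
  let s := Finset.Ioc ⌊Real.exp y⌋₊ ⌊Real.exp (y + 1 / L)⌋₊
  have hcard : Real.exp y / L - 1 ≤ s.card := by
    have h1 : ⌊Real.exp (y + 1 / L)⌋₊ ≤ s.card + ⌊Real.exp y⌋₊ := by
      simp only [s, Nat.card_Ioc]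
      omega
    have h1' : (⌊Real.exp (y + 1 / L)⌋₊ : ℝ) ≤ s.card + ⌊Real.exp y⌋₊ := by exact_mod_cast h1
    have h2 := Nat.floor_le (Real.exp_pos y).le
    have h3 := Nat.lt_floor_add_one (Real.exp (y + 1 / L))
    have h4 : Real.exp y * (1 / L + 1) ≤ Real.exp (y + 1 / L) := by
      rw [Real.exp_add]
      gcongr
      exact Real.add_one_le_exp _
    have h5 : Real.exp y * (1 / L + 1) = Real.exp y / L + Real.exp y := by ring
    linarith
  refine le_trans ?_ ((summable_rpow_mul_fejer hL hσ y).sum_le_tsum s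
    fun n _ => mul_nonneg (by positivity) (fejer_nonneg hL _))
  calc _ ≤ L / 4 * (Real.exp (-σ * (y + 1 / L)) * s.card) := by gcongr
    _ = s.card • (Real.exp (-σ * (y + 1 / L)) * (L / 4)) := by
        rw [nsmul_eq_mul]
        ring
    _ ≤ _ := by
        refine Finset.card_nsmul_le_sum _ _ _ fun n hn => ?_
        obtain ⟨h1, h2⟩ := Finset.mem_Ioc.1 hn
        have h1 : Real.exp y < n := (Nat.floor_lt (Real.exp_pos y).le).1 h1
        have h2 : n ≤ Real.exp (y + 1 / L) := (Nat.le_floor_iff (Real.exp_pos _).le).1 h2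
        have hn0 : (0 : ℝ) < n := (Real.exp_pos y).trans h1
        have h3 : y ≤ Real.log n := (Real.le_log_iff_exp_le hn0).2 h1.le
        have h4 : Real.log n ≤ y + 1 / L := (Real.log_le_iff_le_exp hn0).2 h2
        refine mul_le_mul ?_ (le_fejer hL ?_) (by positivity) (by positivity)
        · rw [Real.rpow_def_of_pos hn0, Real.exp_le_exp]
          nlinarith
        · rw [abs_le]
          constructor <;> linarith [one_div_pos.2 hL]

theorem eventually_exists_prime_abs_log_sub_lt {ε : ℝ} (hε : 0 < ε) :
    ∀ᶠ y : ℝ in atTop, ∃ p : ℕ, p.Prime ∧ |Real.log p - y| < ε := by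
  obtain ⟨Φ, hΦ, hΦL⟩ := exists_continuousOn_eq_LSeries_vonMangoldt_sub_one
  obtain ⟨C, hC⟩ := exists_sum_vonMangoldt_div_le
  obtain ⟨D, hD⟩ := psi_sub_theta_le_mul_sqrt
  let A : ℝ := 2 * (1 + 1 / ε ^ 2) * C
  let L : ℝ := max 1 (24 * A)
  have hL1 : 1 ≤ L := le_max_left _ _
  have hL : 0 < L := one_pos.trans_le hL1
  have hAL : A / L ≤ 1 / 24 := by
    rw [div_le_div_iff₀ hL (by norm_num)]
    linarith [le_max_right 1 (24 * A)]
  let J : ℝ → ℝ → ℂ := fun σ y => ∫ t in (0 : ℝ)..L, ((1 - t / L : ℝ) : ℂ) *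
    (Complex.exp (-(t * y) * Complex.I) * Φ (σ - t * Complex.I))
  let E : ℝ → ℝ := fun y => L / 4 * (Real.exp (-1 * (y + 1 / L)) * (Real.exp y / L - 1)) +
    (J 1 y).re - L * Real.exp (ε - y) * (D * √(Real.exp (y + ε)))
  have hle : ∀ y, (∀ p : ℕ, p.Prime → ε ≤ |Real.log p - y|) → E y ≤ A / L := by
    intro y hp
    have hσ : ∀ σ : ℝ, 1 < σ →
        L / 4 * (Real.exp (-σ * (y + 1 / L)) * (Real.exp y / L - 1)) + (J σ y).re ≤
          A / L + L * Real.exp (ε - y) * (D * √(Real.exp (y + ε))) := by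
      intro σ hσ
      have h1 := hasSum_mul_fejer hσ (fun t => hΦL _ (by simpa using hσ)) hL y
      have h2 := h1.add (summable_rpow_mul_fejer hL hσ y).hasSum
      have h3 := h2.congr_fun (g := fun n : ℕ =>
        vonMangoldt n * (n : ℝ) ^ (-σ) * fejer L (Real.log n - y)) fun n => by ring
      have h4 := hasSum_le_of_sum_le h3 fun s =>
        sum_vonMangoldt_mul_fejer_le hε hL hσ (hC y) hp s
      have h5 := le_tsum_rpow_mul_fejer hL hσ y
      have h6 : L * Real.exp (ε - y) * (ψ (Real.exp (y + ε)) - θ (Real.exp (y + ε))) ≤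
          L * Real.exp (ε - y) * (D * √(Real.exp (y + ε))) := by
        gcongr
        exact hD _
      have h7 : 2 / L * (1 + 1 / ε ^ 2) * C = A / L := by ring
      linarith
    have hlim : Tendsto (fun σ : ℝ =>
        L / 4 * (Real.exp (-σ * (y + 1 / L)) * (Real.exp y / L - 1)) + (J σ y).re) (𝓝[>] 1)
        (𝓝 (L / 4 * (Real.exp (-1 * (y + 1 / L)) * (Real.exp y / L - 1)) + (J 1 y).re)) := by
      refine Tendsto.add ?_ ?_
      · exact Continuous.tendsto' (by fun_prop) 1 _ rfl |>.mono_left nhdsWithin_le_nhds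
      · have h := tendsto_integral_nhdsGT_one hΦ L y
        refine (Complex.continuous_re.tendsto _).comp ?_
        simpa only [J, Complex.ofReal_one] using h
    have := le_of_tendsto hlim (eventually_mem_nhdsWithin.mono hσ)
    simp only [E]
    linarith
  have hE : Tendsto E atTop (𝓝 (Real.exp (-1 / L) / 4)) := by
    have h0 : Tendsto (fun y : ℝ => Real.exp (-y)) atTop (𝓝 0) :=
      Real.tendsto_exp_neg_atTop_nhds_zero
    have h1 : Tendsto (fun y : ℝ => Real.exp (-(y / 2))) atTop (𝓝 0) :=
      h0.comp (tendsto_id.atTop_div_const two_pos)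
    have h2 : Tendsto (fun y => (J 1 y).re) atTop (𝓝 0) := by
      have h := tendsto_integral_exp_atTop (Ψ := fun t => Φ (1 - t * Complex.I)) hL
      simpa [J, Function.comp_def] using (Complex.continuous_re.tendsto 0).comp h
    have h3 := (((h0.const_mul (L / 4 * Real.exp (-1 / L))).const_sub
      (Real.exp (-1 / L) / 4)).add h2).sub
      (h1.const_mul (L * D * Real.exp (3 * ε / 2)))
    simp only [mul_zero, sub_zero, add_zero] at h3
    refine h3.congr fun y => ?_
    have e1 : Real.exp (-1 * (y + 1 / L)) = Real.exp (-1 / L) * Real.exp (-y) := by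
      rw [← Real.exp_add]
      congr 1
      ring
    have e2 : Real.exp (ε - y) * √(Real.exp (y + ε)) =
        Real.exp (3 * ε / 2) * Real.exp (-(y / 2)) := by
      rw [← Real.exp_half, ← Real.exp_add, ← Real.exp_add]
      congr 1
      ring
    have e3 : Real.exp (-y) * Real.exp y = 1 := by
      rw [← Real.exp_add, neg_add_cancel, Real.exp_zero]
    have e4 : L * L⁻¹ = 1 := mul_inv_cancel₀ hL.ne'
    simp only [E]
    rw [e1]
    linear_combination L * D * e2 - (1 / 4 * Real.exp (-1 / L) * e4) -
      (1 / 4 * Real.exp (-1 / L) * L * L⁻¹) * e3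
  have hlt : A / L < Real.exp (-1 / L) / 4 := by
    have h1 : (-1 : ℝ) ≤ -1 / L := by
      rw [neg_div, neg_le_neg_iff, div_le_one hL]
      exact hL1
    have h2 : Real.exp (-1) ≤ Real.exp (-1 / L) := Real.exp_le_exp.2 h1
    have h3 : (1 : ℝ) / 3 < Real.exp (-1) := by
      rw [Real.exp_neg, one_div]
      exact inv_strictAnti₀ (Real.exp_pos 1) (by linarith [Real.exp_one_lt_d9])
    linarith
  filter_upwards [hE.eventually_const_lt hlt] with y hy
  by_contra! h
  exact absurd (hle y h) (not_le.2 hy)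

theorem eventually_exists_prime_le_mul {ε : ℝ} (hε : 0 < ε) :
    ∀ᶠ k : ℕ in atTop, ∃ p : ℕ, p.Prime ∧ k ≤ p ∧ (p : ℝ) ≤ (1 + ε) * k := by
  have hδ : 0 < Real.log (1 + ε) / 2 := by
    have := Real.log_pos (by linarith : 1 < 1 + ε)
    positivity
  have h := ((tendsto_atTop_add_const_right _ (Real.log (1 + ε) / 2)
    Real.tendsto_log_atTop).comp tendsto_natCast_atTop_atTop).eventually
    (eventually_exists_prime_abs_log_sub_lt hδ)
  filter_upwards [h, eventually_gt_atTop 0] with k ⟨p, hp, hpk⟩ hk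
  rw [abs_lt, Function.comp_apply] at hpk
  have hk0 : (0 : ℝ) < k := Nat.cast_pos.2 hk
  have hp0 : (0 : ℝ) < p := Nat.cast_pos.2 hp.pos
  refine ⟨p, hp, ?_, ?_⟩
  · have : Real.log k ≤ Real.log p := by linarith
    exact_mod_cast (Real.log_le_log_iff hk0 hp0).1 this
  · rw [← Real.log_le_log_iff hp0 (by positivity), Real.log_mul (by positivity) hk0.ne']
    linarith

end PrimeGaps

theorem eventually_sufficientSlack (K : ℕ) :
    ∀ᶠ u : ℕ in Filter.atTop, ∀ k ≤ K * u, SufficientSlack k u := by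
  have h := tendsto_pow_const_mul_const_pow_of_abs_lt_one 2
    (by rw [abs_lt]; constructor <;> norm_num : |(53 / 54 : ℝ)| < 1)
  have hK : (0 : ℝ) < 1 / (28 * (K + 1)) ^ 2 := by positivity
  filter_upwards [h.eventually_lt_const hK, Filter.eventually_ge_atTop 1] with u hu hu1 k hk
  rw [lt_div_iff₀ (by positivity), div_pow] at hu
  have h54 : (0 : ℝ) < 54 ^ u := by positivity
  have hu' : (28 * ((K + 1) * u)) ^ 2 * 53 ^ u ≤ (54 : ℝ) ^ u := by
    have : (28 * ((K + 1) * u)) ^ 2 * (53 : ℝ) ^ u =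
        (u : ℝ) ^ 2 * (53 ^ u / 54 ^ u) * (28 * (K + 1)) ^ 2 * 54 ^ u := by
      field_simp
    rw [this]
    exact mul_le_of_le_one_left h54.le hu.le
  have hu'' : (28 * ((K + 1) * u)) ^ 2 * 53 ^ u ≤ 54 ^ u := by exact_mod_cast hu'
  refine le_trans (Nat.mul_le_mul_right _ ?_) hu''
  have h1 : k + u ≤ (K + 1) * u := by linarith
  have h2 : 27 * (k + u) + 1 ≤ 28 * ((K + 1) * u) := by omega
  rw [sq]
  exact Nat.mul_le_mul (by omega) h2

theorem exists_modChromaticIndex_le {k : ℕ} (hk : 2 ≤ k) :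
    ∃ N : ℕ, ∀ (V : Type) [Fintype V] (G : SimpleGraph V), modChromaticIndex k G ≤ N := by
  obtain ⟨p, hp, hkp, hpk⟩ := Nat.exists_prime_lt_and_le_two_mul k (by omega)
  obtain ⟨u, hu, hku⟩ := ((eventually_sufficientSlack 1).and
    (Filter.eventually_ge_atTop (k + 8))).exists
  exact ⟨4 * p + 3 * k + 12 * u, fun V _ G => modChromaticIndex_le hk hp hkp.le (by omega)
    (by omega) (hu k (by omega)) (by nlinarith) G⟩

theorem eventually_exists_modChromaticIndex_le {ε : ℝ} (hε : 0 < ε) :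
    ∀ᶠ k : ℕ in Filter.atTop, ∃ N : ℕ, (N : ℝ) ≤ (7 + ε) * k ∧
      ∀ (V : Type) [Fintype V] (G : SimpleGraph V), modChromaticIndex k G ≤ N := by
  obtain ⟨δ, hδ, hδ1, hδε⟩ : ∃ δ : ℝ, 0 < δ ∧ δ ≤ 1 ∧ 17 * δ ≤ ε :=
    ⟨min 1 (ε / 17), by positivity, min_le_left _ _, by linarith [min_le_right 1 (ε / 17)]⟩
  obtain ⟨K, hK⟩ := exists_nat_ge (1 / δ)
  have hu : Filter.Tendsto (fun k : ℕ => ⌈δ * k⌉₊) Filter.atTop Filter.atTop :=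
    tendsto_nat_ceil_atTop.comp (tendsto_natCast_atTop_atTop.const_mul_atTop hδ)
  have hk12 : ∀ᶠ k : ℕ in Filter.atTop, 12 ≤ δ * k :=
    (tendsto_natCast_atTop_atTop.const_mul_atTop hδ).eventually_ge_atTop 12
  filter_upwards [eventually_exists_prime_le_mul hδ, hu.eventually (eventually_sufficientSlack K),
    hu.eventually_ge_atTop (5 * K + 4), hk12, Filter.eventually_ge_atTop 2]
    with k ⟨p, hp, hkp, hpk⟩ hslack hularge hk12 hk2
  have hk0 : (0 : ℝ) < k := Nat.cast_pos.2 (by omega)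
  have hu_ge := Nat.le_ceil (δ * k)
  have hu_lt := Nat.ceil_lt_add_one (by positivity : 0 ≤ δ * k)
  generalize ⌈δ * (k : ℝ)⌉₊ = u at *
  have hku : k ≤ K * u := by
    have : (k : ℝ) ≤ K * u :=
      calc (k : ℝ) = 1 / δ * (δ * k) := by field_simp
        _ ≤ K * u := by gcongr
    exact_mod_cast this
  have hp2 : p ≤ 2 * k := by
    have : (p : ℝ) ≤ 2 * k := by nlinarith
    exact_mod_cast this
  refine ⟨4 * p + 3 * k + 12 * u, ?_, fun V _ G => modChromaticIndex_le hk2 hp hkp (by omega)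
    (by omega) (hslack k hku) (by nlinarith) G⟩
  push_cast
  nlinarith

theorem statement1 :
    ∃ f : ℕ → ℝ, Filter.Tendsto (fun k => f k / k) Filter.atTop (nhds 0) ∧
      ∀ (k : ℕ), Odd k → 3 ≤ k → ∀ (V : Type) [Fintype V] (G : SimpleGraph V),
        (modChromaticIndex k G : ℝ) ≤ 7 * (k : ℝ) + f k := by
  let bounds : ℕ → Set ℕ := fun k =>
    {N | ∀ (V : Type) [Fintype V] (G : SimpleGraph V), modChromaticIndex k G ≤ N}
  refine ⟨fun k => max (sInf (bounds k) - 7 * k : ℝ) 0, ?_, fun k _ hk V _ G => ?_⟩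
  · rw [Metric.tendsto_atTop']
    intro ε hε
    have h := eventually_exists_modChromaticIndex_le (half_pos hε)
    obtain ⟨k₀, hk₀⟩ := (h.and (Filter.eventually_ge_atTop 1)).exists_forall_of_atTop
    refine ⟨k₀, fun k hk => ?_⟩
    obtain ⟨⟨N, hN, hbound⟩, hk1⟩ := hk₀ k hk.le
    have hk0 : (0 : ℝ) < k := Nat.cast_pos.2 hk1
    have hle : ((sInf (bounds k) : ℕ) : ℝ) ≤ N := Nat.cast_le.2 (Nat.sInf_le hbound)
    rw [Real.dist_0_eq_abs, abs_of_nonneg (by positivity), div_lt_iff₀ hk0]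
    refine max_lt ?_ (by positivity)
    nlinarith
  · have hmem : sInf (bounds k) ∈ bounds k :=
      Nat.sInf_mem (exists_modChromaticIndex_le (by omega))
    have h : (modChromaticIndex k G : ℝ) ≤ (sInf (bounds k) : ℕ) := Nat.cast_le.2 (hmem V G)
    linarith [le_max_left ((sInf (bounds k) : ℕ) - 7 * k : ℝ) 0]
end

section
/- Let k ≥ 2 be an even integer. If G is a finite simple graph on n vertices that does not contain any non-empty k-divisible subgraph, then the number of edges of G satisfies e(G) ≤ (q(3k/2) − 1)·n. -/
/-- A graph is `k`-divisible if every vertex has degree divisible by `k`. -/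
def KDivisible {V : Type*} (k : ℕ) (H : SimpleGraph V) : Prop :=
  ∀ v : V, k ∣ {u : V | H.Adj v u}.ncard

/-- `G` contains no non-empty `k`-divisible subgraph. -/
def NoKDivisibleSubgraph {V : Type*} (k : ℕ) (G : SimpleGraph V) : Prop :=
  ∀ H : SimpleGraph V, H ≤ G → KDivisible k H → H = ⊥

/-- `q m` is the smallest prime that is greater than or equal to `m`. -/
noncomputable def q (m : ℕ) : ℕ :=
  sInf {p : ℕ | p.Prime ∧ m ≤ p}

open Finset

namespace SimpleGraph

/-- If edge weights have total less than `#U + 1` at every vertex set `U` and at least `1` across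
every odd cut, then the graph has a perfect matching. -/
theorem exists_isPerfectMatching_of_weight {W : Type*} [Fintype W] [DecidableEq W]
    (Γ : SimpleGraph W) (w : W → W → ℝ) (w_nonneg : ∀ x y, 0 ≤ w x y)
    (w_symm : ∀ x y, w x y = w y x) (w_adj : ∀ x y, w x y ≠ 0 → Γ.Adj x y)
    (w_lt : ∀ U : Finset W, ∑ x ∈ U, ∑ y, w x y < #U + 1)
    (w_cut : ∀ K : Finset W, Odd #K → 1 ≤ ∑ x ∈ K, ∑ y ∈ Kᶜ, w x y) :
    ∃ M : Γ.Subgraph, M.IsPerfectMatching := by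
  classical
  rw [tutte]
  intro u hu
  obtain ⟨U, rfl⟩ := u.toFinite.exists_finset_coe
  set Γ' := ((⊤ : Γ.Subgraph).deleteVerts U).coe with hΓ'
  let K : Γ'.ConnectedComponent → Finset W := fun C ↦ C.supp.toFinset.map (.subtype _)
  have hK : ∀ C x, x ∈ K C ↔ ∃ h, Γ'.connectedComponentMk ⟨x, h⟩ = C := by
    intro C x
    simp [K]
  obtain ⟨O, hO⟩ := Γ'.oddComponents.toFinite.exists_finset_coe
  have hdisj : Set.PairwiseDisjoint (O : Set Γ'.ConnectedComponent) K := by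
    intro C _ D _ hCD
    rw [Function.onFun, Finset.disjoint_left]
    intro x hx hx'
    obtain ⟨h, rfl⟩ := (hK _ _).1 hx
    obtain ⟨h', rfl⟩ := (hK _ _).1 hx'
    exact hCD rfl
  have hodd : ∀ C ∈ O, 1 ≤ ∑ x ∈ K C, ∑ y ∈ U, w x y := by
    intro C hC
    have hC : C ∈ Γ'.oddComponents := hO ▸ hC
    refine (w_cut (K C) ?_).trans (sum_le_sum fun x hx ↦ ?_)
    · rwa [card_map, ← Set.ncard_eq_toFinset_card']
    · rw [← sum_filter_ne_zero]
      refine sum_le_sum_of_subset_of_nonneg ?_ fun _ _ _ ↦ w_nonneg _ _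
      intro y hy
      simp only [mem_filter, mem_compl] at hy
      by_contra hyU
      obtain ⟨h, rfl⟩ := (hK _ _).1 hx
      have hy' : y ∈ ((⊤ : Γ.Subgraph).deleteVerts U).verts := by simp [hyU]
      refine hy.1 ((hK _ _).2 ⟨hy', ?_⟩)
      refine ConnectedComponent.connectedComponentMk_eq_of_adj ?_
      have hxu : x ∉ U := by simpa using h
      have := (w_adj _ _ hy.2).symm
      simp [hΓ', hxu, hyU, this]
  have h1 : (#O : ℝ) ≤ ∑ C ∈ O, ∑ x ∈ K C, ∑ y ∈ U, w x y := by
    simpa using card_nsmul_le_sum O _ 1 hodd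
  rw [← sum_biUnion hdisj] at h1
  have h2 : ∑ x ∈ O.biUnion K, ∑ y ∈ U, w x y ≤ ∑ x, ∑ y ∈ U, w x y :=
    sum_le_univ_sum_of_nonneg fun x ↦ sum_nonneg fun _ _ ↦ w_nonneg _ _
  have h3 := w_lt U
  have h4 : (#O : ℝ) < #U + 1 := by
    refine (h1.trans (h2.trans_eq ?_)).trans_lt h3
    rw [sum_comm]
    exact sum_congr rfl fun x _ ↦ sum_congr rfl fun y _ ↦ w_symm _ _
  have h5 : #O < #U + 1 := by exact_mod_cast h4
  rw [IsTutteViolator, ← hΓ', ← hO, Set.ncard_coe_finset, Set.ncard_coe_finset] at hu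
  omega

end SimpleGraph

namespace SimpleGraph

section FactorGadget

variable {V : Type*} (G : SimpleGraph V) (c : V → ℕ)

/-- The gadget whose perfect matchings encode subgraphs of `G` in which exactly `c v` edges are
missing at each vertex `v`: the vertices are the darts of `G` together with `c v` cores at each
vertex `v`, every dart is joined to its reversal and to the cores at its initial vertex. -/
def factorGadget : SimpleGraph (G.Dart ⊕ Σ v, Fin (c v)) where
  Adj
    | .inl a, .inl b => b = a.symm
    | .inl a, .inr i => a.fst = i.1
    | .inr i, .inl a => a.fst = i.1
    | .inr _, .inr _ => False
  symm := ⟨by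
    rintro (a | i) (b | j) h
    · simpa using congrArg Dart.symm h.symm
    all_goals exact h⟩
  loopless := ⟨by
    rintro (a | i) h
    · exact a.symm_ne h.symm
    · exact h⟩

/-- The fractional perfect matching of the gadget giving weight `α` to each edge of `G`. -/
noncomputable def factorWeight [DecidableEq V] (α : ℝ) :
    (G.Dart ⊕ Σ v, Fin (c v)) → (G.Dart ⊕ Σ v, Fin (c v)) → ℝ
  | .inl a, .inl b => if b = a.symm then α else 0
  | .inl a, .inr i => if a.fst = i.1 then (1 - α) / c i.1 else 0
  | .inr i, .inl a => if a.fst = i.1 then (1 - α) / c i.1 else 0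
  | .inr _, .inr _ => 0

variable {G c}

theorem exists_degree_eq_of_factorGadget [Fintype V] [DecidableEq V] [DecidableRel G.Adj]
    {f : V → ℕ} (hdeg : ∀ v, G.degree v = f v + c v) {M : (G.factorGadget c).Subgraph}
    (hM : M.IsPerfectMatching) : ∃ F ≤ G, ∀ v, {u | F.Adj v u}.ncard = f v := by
  classical
  rw [Subgraph.isPerfectMatching_iff] at hM
  let F : SimpleGraph V :=
    { Adj := fun u v ↦ ∃ h : G.Adj u v, M.Adj (.inl ⟨(u, v), h⟩) (.inl ⟨(v, u), h.symm⟩)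
      symm := ⟨fun u v ⟨h, h'⟩ ↦ ⟨h.symm, h'.symm⟩⟩
      loopless := ⟨fun u ⟨h, _⟩ ↦ G.loopless.irrefl u h⟩ }
  refine ⟨F, fun u v h ↦ h.1, fun v ↦ ?_⟩
  have hpartner : ∀ i : Σ v, Fin (c v), ∃ a : G.Dart, a.fst = i.1 ∧ M.Adj (.inr i) (.inl a) := by
    intro i
    obtain ⟨y, hy, -⟩ := hM (.inr i)
    rcases y with a | j
    · exact ⟨a, M.adj_sub hy, hy⟩
    · exact (M.adj_sub hy).elim
  choose m hm_fst hm using hpartner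
  have h1 : {u | F.Adj v u}.ncard = #{a : G.Dart | a.fst = v ∧ M.Adj (.inl a) (.inl a.symm)} := by
    rw [Set.ncard_eq_toFinset_card']
    refine card_bij (fun u hu ↦ ⟨(v, u), (show F.Adj v u by simpa using hu).1⟩) ?_ ?_ ?_
    · intro u hu
      have hu : F.Adj v u := by simpa using hu
      simpa using hu.2
    · intro a _ b _ hab
      simpa using congrArg (fun d : G.Dart ↦ d.snd) hab
    · rintro ⟨⟨w, u⟩, h⟩ ha
      simp only [mem_filter, mem_univ, true_and] at ha
      obtain ⟨rfl, ha⟩ := ha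
      exact ⟨u, by simpa [F] using ⟨h, ha⟩, rfl⟩
  have h2 : c v = #{a : G.Dart | a.fst = v ∧ ¬ M.Adj (.inl a) (.inl a.symm)} := by
    rw [← Fintype.card_fin (c v), ← card_univ]
    refine card_bij (fun i _ ↦ m ⟨v, i⟩) ?_ ?_ ?_
    · intro i _
      simp only [mem_filter, mem_univ, true_and]
      refine ⟨hm_fst ⟨v, i⟩, fun h ↦ ?_⟩
      simpa using (hM _).unique h (hm ⟨v, i⟩).symm
    · intro i _ j _ hij
      have h := (hm ⟨v, i⟩).symm
      change m ⟨v, i⟩ = m ⟨v, j⟩ at hij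
      rw [hij] at h
      simpa using (hM _).unique h (hm ⟨v, j⟩).symm
    · intro a ha
      simp only [mem_filter, mem_univ, true_and] at ha
      obtain ⟨rfl, ha⟩ := ha
      obtain ⟨y, hy, -⟩ := hM (.inl a)
      rcases y with b | ⟨w, i⟩
      · obtain rfl : b = a.symm := M.adj_sub hy
        exact (ha hy).elim
      · obtain rfl : a.fst = w := M.adj_sub hy
        exact ⟨i, mem_univ _, by simpa using (hM _).unique (hm ⟨_, i⟩) hy.symm⟩
  have h3 := card_filter_add_card_filter_not (s := ({a : G.Dart | a.fst = v} : Finset _))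
    (fun a : G.Dart ↦ M.Adj (.inl a) (.inl a.symm))
  rw [filter_filter, filter_filter, ← h1, ← h2, G.dart_fst_fiber_card_eq_degree, hdeg] at h3
  omega

theorem sum_dart_fst [Fintype V] [DecidableEq V] [DecidableRel G.Adj] {R : Type*} [Semiring R]
    (g : V → R) : ∑ a : G.Dart, g a.fst = ∑ v, G.degree v * g v := by
  rw [← sum_fiberwise univ (fun a : G.Dart ↦ a.fst)]
  refine sum_congr rfl fun v _ ↦ ?_
  rw [sum_congr rfl (g := fun _ ↦ g v) fun a ha ↦ by rw [(mem_filter.1 ha).2], sum_const,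
    G.dart_fst_fiber_card_eq_degree, nsmul_eq_mul]

variable {α : ℝ}

theorem factorWeight_nonneg [DecidableEq V] (h0 : 0 ≤ α) (h1 : α ≤ 1)
    (x y : G.Dart ⊕ Σ v, Fin (c v)) : 0 ≤ G.factorWeight c α x y := by
  have : 0 ≤ 1 - α := by linarith
  rcases x with a | i <;> rcases y with b | j <;> simp only [factorWeight] <;>
    positivity

theorem factorWeight_symm [DecidableEq V] (x y : G.Dart ⊕ Σ v, Fin (c v)) :
    G.factorWeight c α x y = G.factorWeight c α y x := by
  rcases x with a | i <;> rcases y with b | j <;> simp only [factorWeight]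
  have : b = a.symm ↔ a = b.symm := by
    constructor <;> rintro rfl <;> simp
  simp [this]

theorem adj_of_factorWeight_ne_zero [DecidableEq V] (x y : G.Dart ⊕ Σ v, Fin (c v))
    (h : G.factorWeight c α x y ≠ 0) : (G.factorGadget c).Adj x y := by
  rcases x with a | i <;> rcases y with b | j <;> simp only [factorWeight] at h <;>
    simp_all [factorGadget]

variable [Fintype V] [DecidableEq V] [DecidableRel G.Adj]

theorem sum_factorWeight_inl (a : G.Dart) (hc : c a.fst ≠ 0) :
    ∑ y, G.factorWeight c α (.inl a) y = 1 := by
  rw [Fintype.sum_sum_type, Fintype.sum_sigma]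
  simp only [factorWeight, sum_const, card_univ, Fintype.card_fin, smul_ite, smul_zero,
    sum_ite_eq, sum_ite_eq', mem_univ, if_true, nsmul_eq_mul]
  field_simp
  ring

theorem sum_factorWeight_inr (i : Σ v, Fin (c v)) :
    ∑ y, G.factorWeight c α (.inr i) y = G.degree i.1 * ((1 - α) / c i.1) := by
  rw [Fintype.sum_sum_type]
  simp only [factorWeight, sum_const_zero, add_zero]
  rw [← sum_filter, sum_const, G.dart_fst_fiber_card_eq_degree, nsmul_eq_mul]

theorem sum_factorWeight_lt (hc : ∀ a : G.Dart, c a.fst ≠ 0)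
    (hle : ∀ v, (c v : ℝ) ≤ (1 - α) * G.degree v) (hlt : ∑ v, ((1 - α) * G.degree v - c v) < 1)
    (U : Finset (G.Dart ⊕ Σ v, Fin (c v))) :
    ∑ x ∈ U, ∑ y, G.factorWeight c α x y < #U + 1 := by
  have hnonneg : ∀ x, 0 ≤ ∑ y, G.factorWeight c α x y - 1 := by
    rintro (a | ⟨v, i⟩)
    · rw [sum_factorWeight_inl a (hc a), sub_self]
    · have : (0 : ℝ) < c v := by exact_mod_cast i.pos
      rw [sum_factorWeight_inr, sub_nonneg, mul_div_assoc', le_div_iff₀ this]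
      linarith [hle v]
  have h1 := sum_le_univ_sum_of_nonneg hnonneg (s := U)
  rw [Fintype.sum_sum_type, Fintype.sum_sigma] at h1
  simp only [sum_factorWeight_inl _ (hc _), sum_factorWeight_inr, sub_self, sum_const_zero,
    zero_add, sum_const, sum_sub_distrib (s := U), nsmul_eq_mul, mul_one] at h1
  have h2 : ∑ v, ∑ _i : Fin (c v), (G.degree v * ((1 - α) / c v) - 1) ≤
      ∑ v, ((1 - α) * G.degree v - c v) := by
    refine sum_le_sum fun v _ ↦ ?_
    rw [sum_const, card_univ, Fintype.card_fin, nsmul_eq_mul]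
    rcases eq_or_ne (c v) 0 with h | h
    · simpa [h] using hle v
    · refine le_of_eq ?_
      field_simp
  linarith

theorem factorWeight_cut_eq (K : Finset (G.Dart ⊕ Σ v, Fin (c v))) :
    ∑ x ∈ K, ∑ y ∈ Kᶜ, G.factorWeight c α x y =
      ∑ a : G.Dart, (if .inl a ∈ K ∧ .inl a.symm ∉ K then α else 0) +
        ∑ a : G.Dart, ∑ i : Fin (c a.fst),
          if .inl a ∈ K ↔ .inr ⟨a.fst, i⟩ ∈ K then 0 else (1 - α) / c a.fst := by
  have h : ∑ x ∈ K, ∑ y ∈ Kᶜ, G.factorWeight c α x y =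
      ∑ x, ∑ y, if x ∈ K ∧ y ∉ K then G.factorWeight c α x y else 0 := by
    calc _ = ∑ x, if x ∈ K then ∑ y, if y ∈ Kᶜ then G.factorWeight c α x y else 0 else 0 := by
          simp only [sum_ite_mem, univ_inter]
      _ = _ := sum_congr rfl fun x _ ↦ by by_cases h : x ∈ K <;> simp [h]
  rw [h]
  simp only [Fintype.sum_sum_type, sum_add_distrib, factorWeight, ite_self, sum_const_zero,
    add_zero]
  rw [sum_comm (s := univ (α := Σ v, Fin (c v))), add_assoc, ← sum_add_distrib]
  congr 1
  · refine sum_congr rfl fun a _ ↦ ?_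
    rw [sum_eq_single a.symm]
    · simp
    · intro b _ hb
      simp [hb]
    · simp
  · refine sum_congr rfl fun a _ ↦ ?_
    rw [← sum_add_distrib, Fintype.sum_sigma, sum_eq_single a.fst]
    · refine sum_congr rfl fun i _ ↦ ?_
      by_cases h1 : .inl a ∈ K <;> by_cases h2 : .inr ⟨a.fst, i⟩ ∈ K <;> simp [h1, h2]
    · intro v _ hv
      simp [hv.symm]
    · simp

theorem odd_card_bad_darts {f : V → ℕ} (hdeg : ∀ v, G.degree v = f v + c v)
    (hf : ∀ v, Even (f v)) {K : Finset (G.Dart ⊕ Σ v, Fin (c v))} (hK : Odd #K)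
    (Y : Finset V) (hY : ∀ v i, .inr ⟨v, i⟩ ∈ K ↔ v ∈ Y) :
    Odd #{a : G.Dart | ¬ (.inl a ∈ K ↔ a.fst ∈ Y)} := by
  rw [← ZMod.natCast_eq_one_iff_odd] at hK ⊢
  have h1 : (#K : ZMod 2) = ∑ a : G.Dart, (if .inl a ∈ K then 1 else 0) +
      ∑ v, (c v : ZMod 2) * if v ∈ Y then 1 else 0 := by
    have : (#K : ZMod 2) = ∑ x, if x ∈ K then 1 else 0 := by simp
    rw [this, Fintype.sum_sum_type, Fintype.sum_sigma]
    simp [hY]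
  have h2 : (#{a : G.Dart | ¬ (.inl a ∈ K ↔ a.fst ∈ Y)} : ZMod 2) =
      ∑ a : G.Dart, (if .inl a ∈ K then 1 else 0) + ∑ a : G.Dart, if a.fst ∈ Y then 1 else 0 := by
    rw [← sum_add_distrib, natCast_card_filter]
    refine sum_congr rfl fun a _ ↦ ?_
    by_cases h1 : .inl a ∈ K <;> by_cases h2 : a.fst ∈ Y <;> simp [h1, h2]
    decide
  have h3 : ∀ v, (f v : ZMod 2) = 0 := fun v ↦ (ZMod.natCast_eq_zero_iff_even).2 (hf v)
  refine (h2.trans ?_).trans hK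
  rw [h1, sum_dart_fst (fun v ↦ if v ∈ Y then 1 else 0)]
  simp [hdeg, h3]

theorem one_le_factorWeight_cut {f : V → ℕ} (hdeg : ∀ v, G.degree v = f v + c v)
    (hf : ∀ v, Even (f v)) (hc : ∀ a : G.Dart, c a.fst ≠ 0) (h0 : 0 ≤ α) (hα : 3 * α ≤ 2)
    (hle : ∀ v, (c v : ℝ) ≤ (1 - α) * G.degree v)
    (hbridge : ∀ (Y : Finset V) (a : G.Dart), a.fst ∈ Y → a.snd ∉ Y →
      ∃ b : G.Dart, b ≠ a ∧ b.fst ∈ Y ∧ b.snd ∉ Y)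
    (K : Finset (G.Dart ⊕ Σ v, Fin (c v))) (hK : Odd #K) :
    1 ≤ ∑ x ∈ K, ∑ y ∈ Kᶜ, G.factorWeight c α x y := by
  have ht : ∀ v, 0 ≤ (1 - α) / c v := fun v ↦ by
    have : 0 ≤ 1 - α := by linarith
    positivity
  have hinner : ∀ a : G.Dart, 0 ≤ ∑ i : Fin (c a.fst),
      if .inl a ∈ K ↔ .inr ⟨a.fst, i⟩ ∈ K then 0 else (1 - α) / c a.fst := fun a ↦
    sum_nonneg fun i _ ↦ by split_ifs; exacts [le_rfl, ht _]
  have houter : ∀ a : G.Dart, 0 ≤ if .inl a ∈ K ∧ .inl a.symm ∉ K then α else 0 := fun a ↦ by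
    split_ifs; exacts [h0, le_rfl]
  rw [factorWeight_cut_eq]
  by_cases hsplit : ∃ v i j, .inr ⟨v, i⟩ ∈ K ∧ .inr ⟨v, j⟩ ∉ K
  · obtain ⟨v, i, j, hi, hj⟩ := hsplit
    refine le_add_of_nonneg_of_le (sum_nonneg fun a _ ↦ houter a) ?_
    have hcv : (0 : ℝ) < c v := by exact_mod_cast i.pos
    calc (1 : ℝ) ≤ #{a : G.Dart | a.fst = v} • ((1 - α) / c v) := by
          rw [G.dart_fst_fiber_card_eq_degree, nsmul_eq_mul, mul_div_assoc', le_div_iff₀ hcv]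
          linarith [hle v]
      _ ≤ ∑ a : G.Dart with a.fst = v, _ := card_nsmul_le_sum _ _ _ fun a ha ↦ ?_
      _ ≤ _ := sum_le_univ_sum_of_nonneg hinner
    obtain rfl := (mem_filter.1 ha).2
    obtain ⟨l, hl⟩ : ∃ l, ¬ (.inl a ∈ K ↔ .inr ⟨a.fst, l⟩ ∈ K) := by
      by_cases h : .inl a ∈ K
      exacts [⟨j, by tauto⟩, ⟨i, by tauto⟩]
    refine le_trans ?_ (single_le_sum (fun i _ ↦ ?_) (mem_univ l))
    · rw [if_neg hl]
    · split_ifs; exacts [le_rfl, ht _]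
  · push Not at hsplit
    let Y : Finset V := {v | ∃ i, .inr ⟨v, i⟩ ∈ K}
    have hY : ∀ v i, .inr ⟨v, i⟩ ∈ K ↔ v ∈ Y := fun v i ↦
      ⟨fun h ↦ by simpa [Y] using ⟨i, h⟩, fun h ↦ by
        obtain ⟨j, hj⟩ : ∃ j, .inr ⟨v, j⟩ ∈ K := by simpa [Y] using h
        exact hsplit v j i hj⟩
    have hodd := odd_card_bad_darts hdeg hf hK Y hY
    set B : Finset G.Dart := {a | ¬ (.inl a ∈ K ↔ a.fst ∈ Y)} with hB
    have hsum : ∑ a : G.Dart, ∑ i : Fin (c a.fst),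
        (if .inl a ∈ K ↔ .inr ⟨a.fst, i⟩ ∈ K then 0 else (1 - α) / c a.fst) = #B * (1 - α) := by
      rw [← nsmul_eq_mul, ← sum_const, hB, sum_filter]
      refine sum_congr rfl fun a _ ↦ ?_
      have : (c a.fst : ℝ) ≠ 0 := by exact_mod_cast hc a
      by_cases h : .inl a ∈ K ↔ a.fst ∈ Y
      · simp [hY, h]
      · simp only [hY, h, if_false, not_false_iff, if_true, sum_const, card_univ, Fintype.card_fin,
          nsmul_eq_mul]
        field_simp
    rw [hsum]
    by_cases hB3 : 3 ≤ #B
    · have : (3 : ℝ) ≤ #B := by exact_mod_cast hB3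
      have := sum_nonneg fun a (_ : a ∈ univ) ↦ houter a
      nlinarith
    have hB1 : #B = 1 := by
      obtain ⟨m, hm⟩ := hodd
      omega
    obtain ⟨b, hb⟩ := card_eq_one.1 hB1
    have hgood : ∀ a, a ≠ b → (.inl a ∈ K ↔ a.fst ∈ Y) := by
      intro a ha
      by_contra h
      exact ha (by simpa [hb] using (show a ∈ B by simpa [hB] using h))
    have hbad : ¬ (.inl b ∈ K ↔ b.fst ∈ Y) := by
      have : b ∈ B := by simp [hb]
      simpa [hB] using this
    obtain ⟨a, ha, ha'⟩ : ∃ a : G.Dart, .inl a ∈ K ∧ .inl a.symm ∉ K := by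
      have hbs := hgood b.symm b.symm_ne
      rw [show b.symm.fst = b.snd from rfl] at hbs
      by_cases hcross : b.fst ∈ Y ↔ b.snd ∈ Y
      · by_cases h : .inl b ∈ K
        · exact ⟨b, h, by tauto⟩
        · exact ⟨b.symm, by tauto, by simpa using h⟩
      · have key : ∃ a : G.Dart, a ≠ b ∧ a.symm ≠ b ∧ a.fst ∈ Y ∧ a.snd ∉ Y := by
          by_cases h : b.fst ∈ Y
          · obtain ⟨a, hab, h1, h2⟩ := hbridge Y b h (by tauto)
            refine ⟨a, hab, ?_, h1, h2⟩
            rintro rfl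
            exact h2 h
          · obtain ⟨a, hab, h1, h2⟩ := hbridge Y b.symm (by change b.snd ∈ Y; tauto) h
            refine ⟨a, ?_, ?_, h1, h2⟩
            · rintro rfl
              exact h h1
            · rintro rfl
              simp at hab
        obtain ⟨a, h1, h2, h3, h4⟩ := key
        exact ⟨a, (hgood a h1).2 h3, fun h ↦ h4 ((hgood _ h2).1 h)⟩
    have := single_le_sum (fun a _ ↦ houter a) (mem_univ a)
    simp only [ha, ha', not_false_iff, and_self, if_true] at this
    rw [hB1]
    push_cast
    linarith

/-- A graph without bridges has a subgraph with even prescribed degrees `f` as soon as `f` is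
close to `α` times the degree, where `0 ≤ α ≤ 2 / 3`. -/
theorem exists_factor {f : V → ℕ} (hdeg : ∀ v, G.degree v = f v + c v)
    (hf : ∀ v, Even (f v)) (hc : ∀ a : G.Dart, c a.fst ≠ 0) (h0 : 0 ≤ α) (hα : 3 * α ≤ 2)
    (hle : ∀ v, (c v : ℝ) ≤ (1 - α) * G.degree v) (hlt : ∑ v, ((1 - α) * G.degree v - c v) < 1)
    (hbridge : ∀ (Y : Finset V) (a : G.Dart), a.fst ∈ Y → a.snd ∉ Y →
      ∃ b : G.Dart, b ≠ a ∧ b.fst ∈ Y ∧ b.snd ∉ Y) :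
    ∃ F ≤ G, ∀ v, {u | F.Adj v u}.ncard = f v := by
  obtain ⟨M, hM⟩ := exists_isPerfectMatching_of_weight (G.factorGadget c) (G.factorWeight c α)
    (factorWeight_nonneg h0 (by linarith)) factorWeight_symm adj_of_factorWeight_ne_zero
    (sum_factorWeight_lt hc hle hlt) (one_le_factorWeight_cut hdeg hf hc h0 hα hle hbridge)
  exact exists_degree_eq_of_factorGadget hdeg hM

end FactorGadget

end SimpleGraph

/-- A graph on `n` vertices with more than `(p - 1) * n` edges, `p` prime, contains a non-empty
`p`-divisible subgraph. -/
theorem exists_kDivisible_of_prime {V : Type*} [Fintype V] {p : ℕ} (hp : p.Prime)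
    (G : SimpleGraph V) (h : (p - 1) * Fintype.card V < G.edgeSet.ncard) :
    ∃ H ≤ G, H ≠ ⊥ ∧ KDivisible p H := by
  classical
  have : Fact p.Prime := ⟨hp⟩
  let f : V → MvPolynomial G.edgeSet (ZMod p) := fun v ↦
    ∑ e : G.edgeSet with v ∈ e.1, MvPolynomial.X e ^ (p - 1)
  have hdeg : ∀ v, (f v).totalDegree ≤ p - 1 := by
    intro v
    refine MvPolynomial.totalDegree_finsetSum_le fun e _ ↦ ?_
    simp
  have hsum : ∑ v, (f v).totalDegree < Fintype.card G.edgeSet := by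
    calc ∑ v, (f v).totalDegree ≤ ∑ _v : V, (p - 1) := sum_le_sum fun v _ ↦ hdeg v
      _ = (p - 1) * Fintype.card V := by simp [mul_comm]
      _ < _ := h.trans_eq (by rw [← Nat.card_coe_set_eq, Nat.card_eq_fintype_card])
  have hdvd := char_dvd_card_solutions_of_fintype_sum_lt p hsum
  have hp0 : p - 1 ≠ 0 := by have := hp.two_le; omega
  have hcard : 1 < Fintype.card {x : G.edgeSet → ZMod p // ∀ v, MvPolynomial.eval x (f v) = 0} := by
    refine hp.one_lt.trans_le (Nat.le_of_dvd (Fintype.card_pos_iff.2 ⟨0, fun v ↦ ?_⟩) hdvd)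
    simp [f, hp0]
  obtain ⟨⟨x, hx⟩, hne⟩ := Fintype.exists_ne_of_one_lt_card hcard ⟨0, fun v ↦ by simp [f, hp0]⟩
  have hx0 : x ≠ 0 := by simpa using hne
  obtain ⟨e, he⟩ := Function.ne_iff.1 hx0
  let H : SimpleGraph V :=
    { Adj := fun u v ↦ ∃ h : G.Adj u v, x ⟨s(u, v), h⟩ ≠ 0
      symm := ⟨fun u v ⟨h, h'⟩ ↦ ⟨h.symm, by simpa only [Sym2.eq_swap (a := v)] using h'⟩⟩
      loopless := ⟨fun u ⟨h, _⟩ ↦ G.loopless.irrefl u h⟩ }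
  refine ⟨H, fun u v h ↦ h.1, ?_, fun v ↦ ?_⟩
  · obtain ⟨e, hG⟩ := e
    induction e with | _ u v
    intro hH
    have : H.Adj u v := ⟨hG, he⟩
    simp [hH] at this
  · have hv := hx v
    simp only [f, map_sum, map_pow, MvPolynomial.eval_X, ZMod.pow_card_sub_one] at hv
    rw [← sum_filter, filter_filter, sum_const, nsmul_one, ZMod.natCast_eq_zero_iff] at hv
    · convert hv using 1
      rw [Set.ncard_eq_toFinset_card']
      refine card_bij (fun u hu ↦ ⟨s(v, u), (show H.Adj v u by simpa using hu).1⟩) ?_ ?_ ?_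
      · intro u hu
        have hu : H.Adj v u := by simpa using hu
        simp [hu.2]
      · intro a _ b _ hab
        exact Sym2.congr_right.1 (Subtype.ext_iff.1 hab)
      · rintro ⟨e, heG⟩ he
        simp only [mem_filter, mem_univ, true_and] at he
        obtain ⟨u, rfl⟩ := Sym2.mem_iff_exists.1 he.1
        exact ⟨u, by simpa [H] using ⟨heG, he.2⟩, rfl⟩

/-- A non-empty `p`-divisible graph contains a non-empty `k`-divisible subgraph, for even `k`
with `3 * k ≤ 2 * p`. -/
theorem KDivisible.exists_kDivisible {V : Type*} [Fintype V] {k p : ℕ} (hk0 : 0 < k)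
    (hk : Even k) (hkp : 3 * k ≤ 2 * p) (hkp2 : k + 2 ≤ p) {H : SimpleGraph V} (hH : KDivisible p H)
    (hne : H ≠ ⊥) : ∃ F ≤ H, F ≠ ⊥ ∧ KDivisible k F := by
  classical
  have hdvd : ∀ v, p ∣ H.degree v := fun v ↦ by
    convert hH v using 1
    rw [Set.ncard_eq_toFinset_card', ← SimpleGraph.card_neighborFinset_eq_degree]
    congr 1
  let D : Finset V → Finset (V × V) := fun Y ↦ {x | H.Adj x.1 x.2 ∧ x.1 ∈ Y ∧ x.2 ∉ Y}
  -- `X` is a smallest set of non-isolated vertices with at most one edge leaving it.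
  obtain ⟨X, ⟨hXne, hXpos, hXD⟩, hXmin⟩ : ∃ X : Finset V,
      (X.Nonempty ∧ (∀ v ∈ X, 0 < H.degree v) ∧ #(D X) ≤ 1) ∧
      ∀ Y ⊂ X, Y.Nonempty → 1 < #(D Y) := by
    obtain ⟨u, v, huv⟩ := SimpleGraph.ne_bot_iff_exists_adj.1 hne
    let P : Finset V → Prop := fun X ↦
      X.Nonempty ∧ (∀ v ∈ X, 0 < H.degree v) ∧ #(D X) ≤ 1
    have hP : ({X | P X} : Finset (Finset V)).Nonempty := by
      refine ⟨({v | 0 < H.degree v} : Finset V), ?_⟩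
      simp only [mem_filter, mem_univ, true_and, P]
      refine ⟨⟨u, ?_⟩, fun v hv ↦ by simpa using hv, ?_⟩
      · simpa using (H.degree_pos_iff_exists_adj u).2 ⟨v, huv⟩
      · refine (card_eq_zero.2 ?_).trans_le zero_le_one
        simp only [D, filter_eq_empty_iff, mem_univ, true_and, mem_filter, not_and, not_not]
        exact fun x _ hx _ ↦ (H.degree_pos_iff_exists_adj _).2 ⟨_, hx.symm⟩
    obtain ⟨X, hX, hmin⟩ := exists_min_image _ card hP
    have hX : P X := by simpa using hX
    refine ⟨X, hX, fun Y hY hYne ↦ ?_⟩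
    by_contra! h
    exact (card_lt_card hY).not_ge
      (hmin Y (by simpa using ⟨hYne, fun v hv ↦ hX.2.1 v (hY.1 hv), h⟩))
  let G : SimpleGraph V :=
    { Adj := fun u v ↦ H.Adj u v ∧ u ∈ X ∧ v ∈ X
      symm := ⟨fun u v h ↦ ⟨h.1.symm, h.2.2, h.2.1⟩⟩
      loopless := ⟨fun u h ↦ H.loopless.irrefl u h.1⟩ }
  let ex : V → ℕ := fun v ↦ #{u | H.Adj v u ∧ v ∈ X ∧ u ∉ X}
  have hex_sum : ∑ v, ex v = #(D X) := by
    simp only [ex, D, card_filter, Fintype.sum_prod_type]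
  have hex : ∀ v, ex v ≤ 1 := fun v ↦
    (single_le_sum (fun _ _ ↦ Nat.zero_le _) (mem_univ v)).trans (hex_sum.trans_le hXD)
  have hG_in : ∀ v ∈ X, G.degree v + ex v = H.degree v := by
    intro v hv
    rw [← SimpleGraph.card_neighborFinset_eq_degree, ← SimpleGraph.card_neighborFinset_eq_degree,
      ← card_filter_add_card_filter_not (s := H.neighborFinset v) (· ∈ X)]
    congr 2
    · ext u
      simp [G, hv]
    · simp only [ex, hv, true_and]
      congr 1
      ext u
      simp
  have hG_out : ∀ v ∉ X, G.degree v = 0 := by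
    intro v hv
    rw [← SimpleGraph.card_neighborFinset_eq_degree, card_eq_zero, eq_empty_iff_forall_notMem]
    intro u hu
    exact hv ((SimpleGraph.mem_neighborFinset _ _ _).1 hu).2.1
  obtain ⟨r, rfl⟩ := Nat.exists_eq_add_of_le (show k ≤ p by omega)
  have hr : 2 ≤ r := by omega
  choose m hm using hdvd
  have hm0 : ∀ v ∈ X, 0 < m v := fun v hv ↦ Nat.pos_of_mul_pos_left (hm v ▸ hXpos v hv)
  have hrm : ∀ v ∈ X, 2 ≤ r * m v := fun v hv ↦ by nlinarith [hm0 v hv]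
  let f : V → ℕ := fun v ↦ if v ∈ X then k * m v else 0
  let c : V → ℕ := fun v ↦ if v ∈ X then r * m v - ex v else 0
  have hdeg : ∀ v, G.degree v = f v + c v := by
    intro v
    by_cases hv : v ∈ X
    · have h1 := hG_in v hv
      have h2 := hrm v hv
      have h3 := hex v
      rw [hm, add_mul] at h1
      simp only [f, c, hv, if_true]
      omega
    · simp [f, c, hv, hG_out]
  have hkr : (0 : ℝ) < k + r := by exact_mod_cast (by omega : 0 < k + r)
  have hdiff : ∀ v, (1 - (k : ℝ) / (k + r)) * G.degree v - c v = k / (k + r) * ex v := by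
    intro v
    by_cases hv : v ∈ X
    · have h1 : (ex v : ℝ) + c v = r * m v := by
        have h2 := hrm v hv
        have h3 := hex v
        have : ex v + c v = r * m v := by
          simp only [c, hv, if_true]
          omega
        exact_mod_cast this
      have h2 : (G.degree v : ℝ) + ex v = (k + r) * m v := by
        exact_mod_cast (hG_in v hv).trans (hm v)
      rw [eq_sub_of_add_eq h2, eq_sub_of_add_eq' h1]
      field_simp
      ring
    · have : ex v = 0 := by simp [ex, hv]
      simp [hG_out v hv, c, hv, this]
  obtain ⟨F, hFG, hF⟩ : ∃ F ≤ G, ∀ v, {u | F.Adj v u}.ncard = f v := by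
    refine SimpleGraph.exists_factor (α := (k : ℝ) / (k + r)) hdeg ?_ ?_ (by positivity)
      ?_ ?_ ?_ ?_
    · intro v
      by_cases hv : v ∈ X <;> simp [f, hv, hk.mul_right]
    · intro a
      have ha := a.adj.2.1
      have h2 := hrm _ ha
      have h3 := hex a.fst
      simp only [c, ha, if_true]
      omega
    · rw [mul_div_assoc', div_le_iff₀ hkr]
      exact_mod_cast hkp
    · intro v
      rw [← sub_nonneg, hdiff]
      positivity
    · simp only [hdiff]
      rw [← mul_sum, ← Nat.cast_sum, hex_sum, div_mul_eq_mul_div, div_lt_one hkr]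
      exact_mod_cast (by nlinarith : k * #(D X) < k + r)
    · intro Y a ha ha'
      by_contra! h
      have h1 : D (X ∩ Y) ⊆ insert a.toProd ((D X).filter (·.1 ∈ Y)) := by
        intro x hx
        simp only [D, mem_filter, mem_univ, true_and, mem_inter, not_and, mem_insert] at hx ⊢
        by_cases hxX : x.2 ∈ X
        · left
          by_contra hxa
          exact hx.2.2 hxX (h ⟨x, hx.1, hx.2.1.1, hxX⟩
            (fun h' ↦ hxa (congrArg (·.toProd) h')) hx.2.1.2)
        · exact .inr ⟨⟨hx.1, hx.2.1.1, hxX⟩, hx.2.1.2⟩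
      have h2 : D (X \ Y) ⊆ insert a.symm.toProd ((D X).filter (¬ ·.1 ∈ Y)) := by
        intro x hx
        simp only [D, mem_filter, mem_univ, true_and, mem_sdiff, not_and, not_not,
          mem_insert] at hx ⊢
        by_cases hxX : x.2 ∈ X
        · left
          by_contra hxa
          exact hx.2.1.2 (h ⟨x.swap, hx.1.symm, hxX, hx.2.1.1⟩
            (fun h' ↦ hxa (by rw [← h']; rfl)) (hx.2.2 hxX))
        · exact .inr ⟨⟨hx.1, hx.2.1.1, hxX⟩, hx.2.1.2⟩
      have haX := a.adj.2
      have h3 := hXmin (X ∩ Y) ⟨inter_subset_left, fun h ↦ ha' (mem_inter.1 (h haX.2)).2⟩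
        ⟨a.fst, mem_inter.2 ⟨haX.1, ha⟩⟩
      have h4 := hXmin (X \ Y) ⟨sdiff_subset, fun h ↦ (mem_sdiff.1 (h haX.1)).2 ha⟩
        ⟨a.snd, mem_sdiff.2 ⟨haX.2, ha'⟩⟩
      have h5 := (card_le_card h1).trans (card_insert_le _ _)
      have h6 := (card_le_card h2).trans (card_insert_le _ _)
      have h7 := card_filter_add_card_filter_not (s := D X) (·.1 ∈ Y)
      omega
  refine ⟨F, fun u v h ↦ (hFG h).1, ?_, fun v ↦ ?_⟩
  · rintro rfl
    obtain ⟨v, hv⟩ := hXne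
    have := hF v
    simp only [SimpleGraph.bot_adj, Set.ofPred_false, Set.ncard_empty, f, hv, if_true] at this
    exact (Nat.mul_pos hk0 (hm0 v hv)).ne this
  · rw [hF]
    by_cases hv : v ∈ X <;> simp [f, hv]

theorem statement2 (k : ℕ) (hk : 2 ≤ k) (hkeven : Even k)
    (V : Type) [Fintype V] (G : SimpleGraph V) (hG : NoKDivisibleSubgraph k G) :
    G.edgeSet.ncard ≤ (q (3 * k / 2) - 1) * Fintype.card V := by
  by_contra! h
  obtain ⟨hp, hle⟩ : (q (3 * k / 2)).Prime ∧ 3 * k / 2 ≤ q (3 * k / 2) := by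
    obtain ⟨p, hp, hp'⟩ := Nat.exists_infinite_primes (3 * k / 2)
    exact Nat.sInf_mem (s := {p : ℕ | p.Prime ∧ 3 * k / 2 ≤ p}) ⟨p, hp', hp⟩
  set p := q (3 * k / 2)
  obtain ⟨l, rfl⟩ := hkeven
  suffices ∃ H ≤ G, H ≠ ⊥ ∧ KDivisible (l + l) H by
    obtain ⟨H, hHG, hne, hH⟩ := this
    exact hne (hG H hHG hH)
  obtain rfl | hl : l = 1 ∨ 2 ≤ l := by omega
  · refine exists_kDivisible_of_prime Nat.prime_two G (lt_of_le_of_lt ?_ h)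
    exact Nat.mul_le_mul_right _ (by omega)
  · obtain ⟨H, hHG, hne, hH⟩ := exists_kDivisible_of_prime hp G h
    obtain ⟨F, hFH, hF⟩ := hH.exists_kDivisible (k := l + l) (by omega) (by simp) (by omega)
      (by omega) hne
    exact ⟨F, hFH.trans hHG, hF⟩
end
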